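/- There exists a wait-free interval-linearizable implementation of the queue with weak-emptiness check and multiplicity using only read/write base objects (registers and a read/write wait-free linearizable counter); concretely, the algorithm obtained from IntSeqQueue by replacing the Fetch&Increment object with a read/write wait-free linearizable counter, extending Items to a two-dimensional array Items[1..][1..n] of registers, and simulating each Swap by a read followed by a write, is such an implementation. -/

import Mathlib

/-- Operations of a queue over items in ℕ. -/
inductive QueueOp
  | enq (x : ℕ)
  | deq
  deriving DecidableEq

/-- Possible outputs: `ok` (= true, for enqueue), an item, empty (ε),
or weak-empty (εʷ). -/
inductive QueueRes
  | ok
  | val (x : ℕ)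
  | empty
  | weakEmpty
  deriving DecidableEq

/-- A concurrent history: `m` operations, each with its kind, its invocation time,
and, if completed, its response time and its output (`none` = pending). -/
structure ConcHistory (Op Res : Type) where
  m : ℕ
  op : Fin m → Op
  inv : Fin m → ℕ
  ret : Fin m → Option ℕ
  out : Fin m → Option Res

/-- `op i` precedes `op j`: the response of `i` occurs before the invocation of `j`. -/
def ConcHistory.precedes {Op Res : Type} (h : ConcHistory Op Res) (i j : Fin h.m) : Prop :=
  ∃ t, h.ret i = some t ∧ t < h.inv j

/-- A state of the interval-concurrent queue with weak-emptiness check and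
multiplicity, with pending-dequeue records indexed by the `m` operations of a
history. -/
structure IQState (m : ℕ) where
  q : List ℕ
  P : Fin m → Option (List ℕ)

/-- The atomic events (concurrency classes / linearization points) of the
interval-concurrent queue with weak-emptiness check and multiplicity: as in the
queue with weak-emptiness check, except that a nonempty set of at most `n`
concurrent dequeues may together remove and return the head item. -/
inductive IQEvent (m : ℕ)
  | enq (i : Fin m) (x : ℕ)              -- Enq(x) returning true
  | deqMulti (l : List (Fin m)) (x : ℕ)  -- concurrent Deqs all returning the head x
  | deqEmpty (i : Fin m)                 -- Deq returning ε on the empty queue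
  | deqWeakPoint (i : Fin m)             -- Deq returning εʷ at a single point
  | deqStart (i : Fin m)                 -- a Deq becomes pending: P[i] := current q
  | deqWeakEnd (i : Fin m)               -- a pending Deq returns εʷ (P[i] = ε)
  deriving DecidableEq

/-- Transitions of the interval-concurrent queue with weak-emptiness check and
multiplicity (`n` = number of processes). -/
inductive IQStep (n : ℕ) {m : ℕ} : IQState m → IQEvent m → IQState m → Prop
  | enq (s : IQState m) (i : Fin m) (x : ℕ) :
      IQStep n s (.enq i x) ⟨s.q ++ [x], s.P⟩
  | deqMulti (s : IQState m) (l : List (Fin m)) (x : ℕ) (q' : List ℕ)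
      (hq : s.q = x :: q') (hne : l ≠ []) (hnd : l.Nodup) (hlen : l.length ≤ n) :
      IQStep n s (.deqMulti l x) ⟨q', fun j => (s.P j).map List.tail⟩
  | deqEmpty (s : IQState m) (i : Fin m) (hq : s.q = []) :
      IQStep n s (.deqEmpty i) s
  | deqWeakPoint (s : IQState m) (i : Fin m) (hq : s.q = []) :
      IQStep n s (.deqWeakPoint i) s
  | deqStart (s : IQState m) (i : Fin m) (h : s.P i = none) :
      IQStep n s (.deqStart i) ⟨s.q, Function.update s.P i (some s.q)⟩
  | deqWeakEnd (s : IQState m) (i : Fin m) (h : s.P i = some []) :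
      IQStep n s (.deqWeakEnd i) ⟨s.q, Function.update s.P i none⟩

/-- An execution of the interval-concurrent queue with weak-emptiness check and
multiplicity. -/
inductive IQExec (n : ℕ) {m : ℕ} : IQState m → List (IQEvent m) → IQState m → Prop
  | nil (s : IQState m) : IQExec n s [] s
  | cons {s s' s'' : IQState m} {e : IQEvent m} {es : List (IQEvent m)} :
      IQStep n s e s' → IQExec n s' es s'' → IQExec n s (e :: es) s''

/-- Whether an event belongs to operation `i`. -/
def IQEvent.mentions {m : ℕ} : IQEvent m → Fin m → Bool
  | .enq j _, i => j == i
  | .deqMulti l _, i => decide (i ∈ l)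
  | .deqEmpty j, i => j == i
  | .deqWeakPoint j, i => j == i
  | .deqStart j, i => j == i
  | .deqWeakEnd j, i => j == i

/-- The events of operation `i` in an event sequence. -/
def opEvents {m : ℕ} (E : List (IQEvent m)) (i : Fin m) : List (IQEvent m) :=
  E.filter (fun e => e.mentions i)

/-- An interval-linearization of a history `h` w.r.t. the interval-concurrent
queue with weak-emptiness check and multiplicity (`n` processes): a sequence of
concurrency classes forming an execution of the specification from the initial
(empty) state, containing every completed operation of `h` (and possibly some
pending ones), where several concurrent dequeues may return the same head item in
the same concurrency class, a dequeue returning εʷ either occupies a single point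
(empty queue) or spans an interval from its `deqStart` to its `deqWeakEnd`,
outputs agree with `h` on completed operations, and the real-time order of `h` is
respected. -/
structure IntervalLinearization (n : ℕ) (h : ConcHistory QueueOp QueueRes) where
  events : List (IQEvent h.m)
  lout : Fin h.m → QueueRes
  valid : ∃ sf : IQState h.m, IQExec n ⟨[], fun _ => none⟩ events sf
  out_agree : ∀ i r, h.out i = some r → lout i = r
  complete_included : ∀ i, (h.out i).isSome → opEvents events i ≠ []
  shape : ∀ i : Fin h.m,
    (opEvents events i = []) ∨
    (∃ x, h.op i = QueueOp.enq x ∧ lout i = QueueRes.ok ∧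
        opEvents events i = [IQEvent.enq i x]) ∨
    (∃ x l, h.op i = QueueOp.deq ∧ lout i = QueueRes.val x ∧ i ∈ l ∧
        opEvents events i = [IQEvent.deqMulti l x]) ∨
    (h.op i = QueueOp.deq ∧ lout i = QueueRes.empty ∧
        opEvents events i = [IQEvent.deqEmpty i]) ∨
    (h.op i = QueueOp.deq ∧ lout i = QueueRes.weakEmpty ∧
        (opEvents events i = [IQEvent.deqWeakPoint i] ∨
         opEvents events i = [IQEvent.deqStart i, IQEvent.deqWeakEnd i])) ∨
    (h.op i = QueueOp.deq ∧ h.out i = none ∧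
        opEvents events i = [IQEvent.deqStart i])
  order : ∀ (i j : Fin h.m), h.precedes i j →
    ∀ (ki kj : Fin events.length),
      (events.get ki).mentions i → (events.get kj).mentions j → (ki : ℕ) < (kj : ℕ)

/-- A history is interval-linearizable w.r.t. the interval-concurrent queue with
weak-emptiness check and multiplicity. -/
def IntervalLinearizable (n : ℕ) (h : ConcHistory QueueOp QueueRes) : Prop :=
  Nonempty (IntervalLinearization n h)

/-- Contents of an entry of `Items`: ⊥ (never written), ⊤ (taken), or an item. -/
inductive Cell
  | bot
  | mark
  | val (x : ℕ)
  deriving DecidableEq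

/-- Local control states of a process executing the read/write version of
IntSeqQueue: the Fetch&Increment object is replaced by a read/write wait-free
linearizable counter (read and increment are separate steps), `Items` is a
two-dimensional array of read/write registers (rows indexed from 1, columns from
1 to `n`; the column of `pᵢ` is `i + 1`), and each Swap is simulated by a read
followed by a write. -/
inductive PS
  | idle
  | enq1 (x : ℕ)               -- Enq(x): about to read the counter `Tail`
  | enq2 (x : ℕ) (tail : ℕ)    -- read `tail`: about to increment `Tail`
  | enq3 (x : ℕ) (tail : ℕ)    -- about to write x into `Items[tail][i]`
  | deqReadTail (k tk1 : ℕ)    -- about to read `Tail` for scan number k ∈ {1,2}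
  | deqScan (k tk1 tk tl r s : ℕ)  -- about to read `Items[r][s]`
  | deqWrite (k tk1 tk tl r s : ℕ) (v : Cell)  -- read non-⊥ v: about to write ⊤
  | done (res : QueueRes)       -- computed result, about to respond
  deriving DecidableEq

/-- A record of a completed operation. -/
structure LogEntry (n : ℕ) where
  proc : Fin n
  op : QueueOp
  res : QueueRes
  invT : ℕ
  retT : ℕ

/-- A configuration of the system running the read/write version of IntSeqQueue. -/
structure Config (n : ℕ) where
  tail : ℕ
  items : ℕ → ℕ → Cell
  proc : Fin n → PS
  pend : Fin n → Option (QueueOp × ℕ)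
  log : List (LogEntry n)
  time : ℕ

/-- The initial configuration. -/
def initConfig (n : ℕ) : Config n :=
  { tail := 1
    items := fun _ _ => Cell.bot
    proc := fun _ => PS.idle
    pend := fun _ => none
    log := []
    time := 0 }

/-- One atomic step of process `i` in the read/write version of IntSeqQueue. -/
inductive Step {n : ℕ} : Config n → Fin n → Config n → Prop
  | invEnq (c : Config n) (i : Fin n) (x : ℕ)
      (h : c.proc i = PS.idle) (hp : c.pend i = none) :
      Step c i { c with proc := Function.update c.proc i (PS.enq1 x),
                        pend := Function.update c.pend i (some (QueueOp.enq x, c.time)),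
                        time := c.time + 1 }
  | invDeq (c : Config n) (i : Fin n)
      (h : c.proc i = PS.idle) (hp : c.pend i = none) :
      Step c i { c with proc := Function.update c.proc i (PS.deqReadTail 1 0),
                        pend := Function.update c.pend i (some (QueueOp.deq, c.time)),
                        time := c.time + 1 }
  | enqReadTail (c : Config n) (i : Fin n) (x : ℕ)
      (h : c.proc i = PS.enq1 x) :
      Step c i { c with proc := Function.update c.proc i (PS.enq2 x c.tail),
                        time := c.time + 1 }
  | enqIncTail (c : Config n) (i : Fin n) (x t : ℕ)
      (h : c.proc i = PS.enq2 x t) :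
      Step c i { c with tail := c.tail + 1,
                        proc := Function.update c.proc i (PS.enq3 x t),
                        time := c.time + 1 }
  | enqWrite (c : Config n) (i : Fin n) (x t : ℕ)
      (h : c.proc i = PS.enq3 x t) :
      Step c i { c with items := fun r s =>
                          if r = t ∧ s = (i : ℕ) + 1 then Cell.val x else c.items r s,
                        proc := Function.update c.proc i (PS.done QueueRes.ok),
                        time := c.time + 1 }
  | deqReadTail_pos (c : Config n) (i : Fin n) (k tk1 : ℕ)
      (h : c.proc i = PS.deqReadTail k tk1) (ht : 2 ≤ c.tail) :
      Step c i { c with proc := Function.update c.proc i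
                          (PS.deqScan k tk1 0 (c.tail - 1) 1 1),
                        time := c.time + 1 }
  | deqReadTail_zero_scan1 (c : Config n) (i : Fin n) (tk1 : ℕ)
      (h : c.proc i = PS.deqReadTail 1 tk1) (ht : c.tail ≤ 1) :
      Step c i { c with proc := Function.update c.proc i (PS.deqReadTail 2 0),
                        time := c.time + 1 }
  | deqReadTail_zero_scan2 (c : Config n) (i : Fin n) (tk1 : ℕ)
      (h : c.proc i = PS.deqReadTail 2 tk1) (ht : c.tail ≤ 1) :
      Step c i { c with proc := Function.update c.proc i
                          (PS.done (if tk1 = 0 then QueueRes.empty else QueueRes.weakEmpty)),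
                        time := c.time + 1 }
  | deqRead_bot_col (c : Config n) (i : Fin n) (k tk1 tk tl r s : ℕ)
      (h : c.proc i = PS.deqScan k tk1 tk tl r s)
      (hx : c.items r s = Cell.bot) (hs : s < n) :
      Step c i { c with proc := Function.update c.proc i
                          (PS.deqScan k tk1 tk tl r (s + 1)),
                        time := c.time + 1 }
  | deqRead_bot_row (c : Config n) (i : Fin n) (k tk1 tk tl r s : ℕ)
      (h : c.proc i = PS.deqScan k tk1 tk tl r s)
      (hx : c.items r s = Cell.bot) (hs : n ≤ s) (hr : r < tl) :
      Step c i { c with proc := Function.update c.proc i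
                          (PS.deqScan k tk1 tk tl (r + 1) 1),
                        time := c.time + 1 }
  | deqRead_bot_end_scan1 (c : Config n) (i : Fin n) (tk1 tk tl r s : ℕ)
      (h : c.proc i = PS.deqScan 1 tk1 tk tl r s)
      (hx : c.items r s = Cell.bot) (hs : n ≤ s) (hr : tl ≤ r) :
      Step c i { c with proc := Function.update c.proc i (PS.deqReadTail 2 tk),
                        time := c.time + 1 }
  | deqRead_bot_end_scan2 (c : Config n) (i : Fin n) (tk1 tk tl r s : ℕ)
      (h : c.proc i = PS.deqScan 2 tk1 tk tl r s)
      (hx : c.items r s = Cell.bot) (hs : n ≤ s) (hr : tl ≤ r) :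
      Step c i { c with proc := Function.update c.proc i
                          (PS.done (if tk = tk1 then QueueRes.empty else QueueRes.weakEmpty)),
                        time := c.time + 1 }
  | deqRead_nonbot (c : Config n) (i : Fin n) (k tk1 tk tl r s : ℕ) (v : Cell)
      (h : c.proc i = PS.deqScan k tk1 tk tl r s)
      (hx : c.items r s = v) (hv : v ≠ Cell.bot) :
      Step c i { c with proc := Function.update c.proc i (PS.deqWrite k tk1 tk tl r s v),
                        time := c.time + 1 }
  | deqWrite_val (c : Config n) (i : Fin n) (k tk1 tk tl r s x : ℕ)
      (h : c.proc i = PS.deqWrite k tk1 tk tl r s (Cell.val x)) :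
      Step c i { c with items := fun r' s' =>
                          if r' = r ∧ s' = s then Cell.mark else c.items r' s',
                        proc := Function.update c.proc i (PS.done (QueueRes.val x)),
                        time := c.time + 1 }
  | deqWrite_mark_col (c : Config n) (i : Fin n) (k tk1 tk tl r s : ℕ)
      (h : c.proc i = PS.deqWrite k tk1 tk tl r s Cell.mark) (hs : s < n) :
      Step c i { c with items := fun r' s' =>
                          if r' = r ∧ s' = s then Cell.mark else c.items r' s',
                        proc := Function.update c.proc i
                          (PS.deqScan k tk1 (tk + 1) tl r (s + 1)),
                        time := c.time + 1 }
  | deqWrite_mark_row (c : Config n) (i : Fin n) (k tk1 tk tl r s : ℕ)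
      (h : c.proc i = PS.deqWrite k tk1 tk tl r s Cell.mark) (hs : n ≤ s) (hr : r < tl) :
      Step c i { c with items := fun r' s' =>
                          if r' = r ∧ s' = s then Cell.mark else c.items r' s',
                        proc := Function.update c.proc i
                          (PS.deqScan k tk1 (tk + 1) tl (r + 1) 1),
                        time := c.time + 1 }
  | deqWrite_mark_end_scan1 (c : Config n) (i : Fin n) (tk1 tk tl r s : ℕ)
      (h : c.proc i = PS.deqWrite 1 tk1 tk tl r s Cell.mark) (hs : n ≤ s) (hr : tl ≤ r) :
      Step c i { c with items := fun r' s' =>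
                          if r' = r ∧ s' = s then Cell.mark else c.items r' s',
                        proc := Function.update c.proc i (PS.deqReadTail 2 (tk + 1)),
                        time := c.time + 1 }
  | deqWrite_mark_end_scan2 (c : Config n) (i : Fin n) (tk1 tk tl r s : ℕ)
      (h : c.proc i = PS.deqWrite 2 tk1 tk tl r s Cell.mark) (hs : n ≤ s) (hr : tl ≤ r) :
      Step c i { c with items := fun r' s' =>
                          if r' = r ∧ s' = s then Cell.mark else c.items r' s',
                        proc := Function.update c.proc i
                          (PS.done (if tk + 1 = tk1 then QueueRes.empty else QueueRes.weakEmpty)),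
                        time := c.time + 1 }
  | respond (c : Config n) (i : Fin n) (res : QueueRes) (op : QueueOp) (t0 : ℕ)
      (h : c.proc i = PS.done res) (hp : c.pend i = some (op, t0)) :
      Step c i { c with proc := Function.update c.proc i PS.idle,
                        pend := Function.update c.pend i none,
                        log := c.log ++ [⟨i, op, res, t0, c.time⟩],
                        time := c.time + 1 }

/-- An (infinite) execution of the read/write version of IntSeqQueue. -/
def Run {n : ℕ} (c : ℕ → Config n) (sched : ℕ → Fin n) : Prop :=
  c 0 = initConfig n ∧ ∀ k, Step (c k) (sched k) (c (k + 1))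

/-- The pending operations of a configuration. -/
def pendingList {n : ℕ} (cfg : Config n) : List (QueueOp × ℕ) :=
  (List.finRange n).filterMap cfg.pend

/-- The history of a configuration: its completed operations (from the log)
followed by its pending operations. -/
def historyAt {n : ℕ} (cfg : Config n) : ConcHistory QueueOp QueueRes where
  m := cfg.log.length + (pendingList cfg).length
  op := fun k =>
    if hk : (k : ℕ) < cfg.log.length then (cfg.log.get ⟨k, hk⟩).op
    else ((pendingList cfg).getD ((k : ℕ) - cfg.log.length) (QueueOp.deq, 0)).1
  inv := fun k =>
    if hk : (k : ℕ) < cfg.log.length then (cfg.log.get ⟨k, hk⟩).invT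
    else ((pendingList cfg).getD ((k : ℕ) - cfg.log.length) (QueueOp.deq, 0)).2
  ret := fun k =>
    if hk : (k : ℕ) < cfg.log.length then some (cfg.log.get ⟨k, hk⟩).retT else none
  out := fun k =>
    if hk : (k : ℕ) < cfg.log.length then some (cfg.log.get ⟨k, hk⟩).res else none

/-- A linearization scheme with explicit times: `e k` and `d k` items of the global item order `items`
have been enqueued, respectively dequeued, before step `k`. -/
structure TimedLinearization (n : ℕ) (h : ConcHistory QueueOp QueueRes) where
  N : ℕ
  items : List ℕ
  e : ℕ → ℕ
  d : ℕ → ℕ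
  idx : ℕ → Fin h.m
  dq : Fin h.m → Option ℕ
  T : Fin h.m → ℕ
  U : Fin h.m → ℕ
  nodup : items.Nodup
  e_mono : Monotone e
  d_mono : Monotone d
  e_zero : e 0 = 0
  d_zero : d 0 = 0
  d_le_e : ∀ k ≤ N, d k ≤ e k
  e_final : e N = items.length
  enq_inj : ∀ i j x, h.op i = .enq x → h.op j = .enq x → i = j
  op_idx : ∀ x ∈ items, h.op (idx x) = .enq x
  enq_time : ∀ k < N, ∀ x ∈ items.take (e (k + 1)), x ∉ items.take (e k) →
    h.inv (idx x) < k ∧ ∀ t, h.ret (idx x) = some t → k ≤ t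
  enq_complete : ∀ i x r, h.op i = .enq x → h.out i = some r → r = .ok ∧ x ∈ items
  dq_spec : ∀ i x, dq i = some x →
    h.op i = .deq ∧ x ∈ items.take (d N) ∧ ∀ r, h.out i = some r → r = .val x
  dq_out : ∀ i x, h.op i = .deq → h.out i = some (.val x) → dq i = some x
  deq_time : ∀ k < N, ∀ i x, dq i = some x → x ∈ items.take (d (k + 1)) →
    x ∉ items.take (d k) → h.inv i < k ∧ ∀ t, h.ret i = some t → k ≤ t
  taker : ∀ x ∈ items.take (d N), ∃ i, dq i = some x
  takers_card : ∀ x, ((List.finRange h.m).filter (fun i => dq i = some x)).length ≤ n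
  deq_ne_ok : ∀ i, h.op i = .deq → h.out i ≠ some .ok
  empty_spec : ∀ i, h.op i = .deq → h.out i = some .empty →
    h.inv i < T i ∧ T i < N ∧ (∀ t, h.ret i = some t → T i ≤ t) ∧ d (T i) = e (T i)
  weak_spec : ∀ i, h.op i = .deq → h.out i = some .weakEmpty →
    h.inv i < T i ∧ T i < U i ∧ U i < N ∧ (∀ t, h.ret i = some t → U i ≤ t) ∧ e (T i) ≤ d (U i)

theorem IQExec.append {n m : ℕ} {s s' s'' : IQState m} {E F : List (IQEvent m)}
    (h₁ : IQExec n s E s') (h₂ : IQExec n s' F s'') : IQExec n s (E ++ F) s'' := by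
  induction h₁ with
  | nil => exact h₂
  | cons hs _ ih => exact .cons hs (ih h₂)

theorem iqExec_enqs {n m : ℕ} (idx : ℕ → Fin m) (xs q : List ℕ) (P : Fin m → Option (List ℕ)) :
    IQExec n ⟨q, P⟩ (xs.map fun x => .enq (idx x) x) ⟨q ++ xs, P⟩ := by
  induction xs generalizing q with
  | nil => simpa using IQExec.nil _
  | cons x xs ih =>
    have := ih (q ++ [x])
    rw [List.append_assoc] at this
    exact .cons (.enq _ _ _) this

theorem iqExec_deqs {n m : ℕ} (l : ℕ → List (Fin m)) (xs q : List ℕ) (P : Fin m → Option (List ℕ))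
    (hl : ∀ x ∈ xs, l x ≠ [] ∧ (l x).Nodup ∧ (l x).length ≤ n) :
    IQExec n ⟨xs ++ q, P⟩ (xs.map fun x => .deqMulti (l x) x)
      ⟨q, fun j => (P j).map (List.drop xs.length)⟩ := by
  induction xs generalizing P with
  | nil =>
    have : (fun j => (P j).map (List.drop 0)) = P := by
      funext j
      cases P j <;> simp
    simpa [this] using IQExec.nil _
  | cons x xs ih =>
    have := ih (fun j => (P j).map List.tail) (fun y hy => hl y (by simp [hy]))
    obtain ⟨h₁, h₂, h₃⟩ := hl x (by simp)
    refine .cons (.deqMulti _ _ _ (xs ++ q) (by simp) h₁ h₂ h₃) ?_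
    convert this using 3
    simp [Option.map_map, Function.comp_def]

theorem iqExec_empties {n m : ℕ} (js : List (Fin m)) (s : IQState m) (hq : js ≠ [] → s.q = []) :
    IQExec n s (js.map .deqEmpty) s := by
  induction js with
  | nil => exact .nil _
  | cons j js ih => exact .cons (.deqEmpty _ _ (hq (by simp))) (ih fun _ => hq (by simp))

theorem iqExec_starts {n m : ℕ} (js : List (Fin m)) (q : List ℕ) (P : Fin m → Option (List ℕ))
    (hn : js.Nodup) (hP : ∀ j ∈ js, P j = none) :
    IQExec n ⟨q, P⟩ (js.map .deqStart) ⟨q, fun j => if j ∈ js then some q else P j⟩ := by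
  induction js generalizing P with
  | nil => simpa using IQExec.nil _
  | cons j js ih =>
    rw [List.nodup_cons] at hn
    refine .cons (.deqStart _ _ (hP j (by simp))) ?_
    convert ih (Function.update P j (some q)) hn.2 ?_ using 3 with i
    · by_cases h : i = j
      · simp [h]
      · simp [h]
    · intro i hi
      have : i ≠ j := fun h => hn.1 (h ▸ hi)
      simp [this, hP i (by simp [hi])]

theorem iqExec_ends {n m : ℕ} (js : List (Fin m)) (q : List ℕ) (P : Fin m → Option (List ℕ))
    (hn : js.Nodup) (hP : ∀ j ∈ js, P j = some []) :
    IQExec n ⟨q, P⟩ (js.map .deqWeakEnd) ⟨q, fun j => if j ∈ js then none else P j⟩ := by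
  induction js generalizing P with
  | nil => simpa using IQExec.nil _
  | cons j js ih =>
    rw [List.nodup_cons] at hn
    refine .cons (.deqWeakEnd _ _ (hP j (by simp))) ?_
    convert ih (Function.update P j none) hn.2 ?_ using 3 with i
    · by_cases h : i = j
      · simp [h]
      · simp [h]
    · intro i hi
      have : i ≠ j := fun h => hn.1 (h ▸ hi)
      simp [this, hP i (by simp [hi])]

theorem List.filter_map_eq_ite {α β : Type*} [DecidableEq α] {L : List α} (hL : L.Nodup) (f : α → β)
    (p : β → Bool) (a : α) (hp : ∀ b ∈ L, p (f b) = decide (b = a)) :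
    (L.map f).filter p = if a ∈ L then [f a] else [] := by
  induction L with
  | nil => simp
  | cons b L ih =>
    rw [List.nodup_cons] at hL
    have hb := hp b (by simp)
    have := ih hL.2 fun c hc => hp c (by simp [hc])
    rw [List.map_cons, List.filter_cons, hb, this]
    by_cases h : b = a
    · subst h; simp [hL.1]
    · have : a ≠ b := fun h' => h h'.symm
      simp [h, this]

theorem List.filter_map_finRange {m : ℕ} {β : Type*} (Q : Fin m → Prop) [DecidablePred Q]
    (f : Fin m → β) (p : β → Bool) (i : Fin m) (hp : ∀ b, p (f b) = decide (b = i)) :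
    (((List.finRange m).filter (fun j => Q j)).map f).filter p = if Q i then [f i] else [] := by
  rw [List.filter_map_eq_ite ((List.nodup_finRange m).filter _) f p i fun b _ => hp b]
  simp

theorem List.flatMap_range_ite {β : Type*} (Q R : ℕ → Prop) [DecidablePred Q] [DecidablePred R]
    (a : β) (h0 : ¬ R 0) (hs : ∀ k, R (k + 1) ↔ R k ∨ Q k) (hd : ∀ k, R k → ¬ Q k) (K : ℕ) :
    (List.range K).flatMap (fun k => if Q k then [a] else []) = if R K then [a] else [] := by
  induction K with
  | zero => simp [h0]
  | succ K ih =>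
    rw [List.range_succ, List.flatMap_append, ih]
    have := hs K
    have := hd K
    by_cases h₁ : R K <;> by_cases h₂ : Q K <;> simp_all

theorem List.flatMap_range_two {β : Type*} {t u : ℕ} (htu : t < u) (a b : β) (K : ℕ) :
    (List.range K).flatMap
      (fun k => (if t = k then [a] else []) ++ (if u = k then [b] else [])) =
      (if t < K then [a] else []) ++ (if u < K then [b] else []) := by
  induction K with
  | zero => simp
  | succ K ih =>
    rw [List.range_succ, List.flatMap_append, ih]
    rcases lt_trichotomy t K with h | h | h
    · rcases lt_trichotomy u K with h' | h' | h'
      · simp [h, h', h.ne, h'.ne, h.le, h'.le]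
      · subst h'; simp [h, h.ne, h.le]
      · have : ¬ u < K + 1 := by omega
        have : ¬ u < K := by omega
        simp [*, h.ne, h'.ne', h.le]
    · subst h
      have : ¬ u < t := by omega
      have : ¬ u < t + 1 := by omega
      simp [*, htu.ne']
    · have : ¬ u < K := by omega
      have : ¬ t < K := by omega
      have : ¬ u < K + 1 := by omega
      have : ¬ t < K + 1 := by omega
      have : ¬ u = K := by omega
      have : ¬ t = K := by omega
      simp [*]

theorem List.mem_drop_take_iff {α : Type*} {L : List α} (hL : L.Nodup) {a b : ℕ} (hab : a ≤ b)
    (x : α) : x ∈ (L.take b).drop a ↔ x ∈ L.take b ∧ x ∉ L.take a := by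
  have h₁ : L.take b = L.take a ++ (L.take b).drop a := by
    conv_lhs => rw [← List.take_append_drop a (L.take b), List.take_take, min_eq_left hab]
  have h₂ : (L.take b).Nodup := hL.sublist (List.take_sublist _ _)
  rw [h₁, List.nodup_append] at h₂
  constructor
  · intro hx
    exact ⟨List.mem_of_mem_drop hx, fun h => h₂.2.2 x h x hx rfl⟩
  · rintro ⟨hx, hx'⟩
    rw [h₁, List.mem_append] at hx
    exact hx.resolve_left hx'

namespace TimedLinearization

variable {n : ℕ} {h : ConcHistory QueueOp QueueRes} (D : TimedLinearization n h)

/-- `i` is a completed dequeue that returned `r`. -/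
def Returned (h : ConcHistory QueueOp QueueRes) (r : QueueRes) (i : Fin h.m) : Prop :=
  h.op i = .deq ∧ h.out i = some r

instance (r : QueueRes) : DecidablePred (Returned h r) := fun _ => instDecidableAnd

/-- The dequeues that take item `x`. -/
def takers (x : ℕ) : List (Fin h.m) := (List.finRange h.m).filter (fun i => D.dq i = some x)

def empties (k : ℕ) : List (Fin h.m) :=
  (List.finRange h.m).filter fun i => Returned h .empty i ∧ D.T i = k

def starts (k : ℕ) : List (Fin h.m) :=
  (List.finRange h.m).filter fun i => Returned h .weakEmpty i ∧ D.T i = k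

def ends (k : ℕ) : List (Fin h.m) :=
  (List.finRange h.m).filter fun i => Returned h .weakEmpty i ∧ D.U i = k

def enqs (k : ℕ) : List ℕ := (D.items.take (D.e (k + 1))).drop (D.e k)

def deqs (k : ℕ) : List ℕ := (D.items.take (D.d (k + 1))).drop (D.d k)

/-- The events emitted at step `k`. -/
def block (k : ℕ) : List (IQEvent h.m) :=
  (D.empties k).map .deqEmpty ++ (D.starts k).map .deqStart ++ (D.ends k).map .deqWeakEnd ++
  (D.enqs k).map (fun x => .enq (D.idx x) x) ++
  (D.deqs k).map (fun x => .deqMulti (D.takers x) x)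

/-- The specification state before step `k`. -/
def state (k : ℕ) : IQState h.m where
  q := (D.items.take (D.e k)).drop (D.d k)
  P := fun j =>
    if Returned h .weakEmpty j ∧ D.T j < k ∧ k ≤ D.U j then
      some ((D.items.take (D.e (D.T j))).drop (D.d k))
    else none

def events : List (IQEvent h.m) := (List.range D.N).flatMap D.block

theorem e_le (k : ℕ) (hk : k ≤ D.N) : D.e k ≤ D.items.length := D.e_final ▸ D.e_mono hk

theorem takers_ne_nil {x : ℕ} (hx : x ∈ D.items.take (D.d D.N)) : D.takers x ≠ [] := by
  obtain ⟨i, hi⟩ := D.taker x hx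
  exact List.ne_nil_of_mem (a := i) (by simp [takers, hi])

theorem drop_drop_deqs (k l : ℕ) (hk : k < D.N) :
    ((D.items.take l).drop (D.d k)).drop (D.deqs k).length =
      (D.items.take l).drop (D.d (k + 1)) := by
  have h₁ := D.d_mono (Nat.le_succ k)
  have h₂ := D.d_le_e (k + 1) hk
  have h₃ := D.e_le (k + 1) hk
  have : (D.deqs k).length = D.d (k + 1) - D.d k := by
    simp only [deqs, List.length_drop, List.length_take]
    omega
  rw [List.drop_drop, this]
  congr 1
  simp only [Nat.succ_eq_add_one] at h₁
  omega

theorem exec_block (k : ℕ) (hk : k < D.N) :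
    IQExec n (D.state k) (D.block k) (D.state (k + 1)) := by
  have hd := D.d_mono (Nat.le_succ k)
  have he := D.e_mono (Nat.le_succ k)
  have hde := D.d_le_e k hk.le
  have hde' := D.d_le_e (k + 1) hk
  have hle := D.e_le (k + 1) hk
  simp only [Nat.succ_eq_add_one] at hd he
  have hq : (D.state k).q ++ D.enqs k =
      D.deqs k ++ (D.items.take (D.e (k + 1))).drop (D.d (k + 1)) := by
    have h₁ : D.items.take (D.e (k + 1)) = D.items.take (D.e k) ++ D.enqs k := by
      conv_lhs =>
        rw [← List.take_append_drop (D.e k) (D.items.take (D.e (k + 1))), List.take_take,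
          min_eq_left he]
      rfl
    have h₂ : D.deqs k = ((D.items.take (D.e (k + 1))).drop (D.d k)).take (D.deqs k).length := by
      have : (D.deqs k).length = D.d (k + 1) - D.d k := by
        simp only [deqs, List.length_drop, List.length_take]
        omega
      rw [this, deqs, List.take_drop, List.take_take]
      congr 2
      omega
    have h₃ : (D.state k).q ++ D.enqs k = (D.items.take (D.e (k + 1))).drop (D.d k) := by
      rw [h₁, List.drop_append_of_le_length]
      · rfl
      · rw [List.length_take]; omega
    rw [h₃, ← D.drop_drop_deqs k _ hk]
    conv_rhs => enter [1]; rw [h₂]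
    rw [List.take_append_drop]
  refine .append (s' := ⟨(D.state k).q ++ D.enqs k, fun j => if j ∈ D.ends k then none else
    if j ∈ D.starts k then some (D.state k).q else (D.state k).P j⟩)
    (.append (.append (.append (iqExec_empties _ (D.state k) ?_)
    (iqExec_starts _ _ _ ?_ ?_)) (iqExec_ends _ _ _ ?_ ?_)) (iqExec_enqs _ _ _ _)) ?_
  · intro hne
    obtain ⟨i, hi⟩ := List.exists_mem_of_ne_nil _ hne
    simp only [empties, List.mem_filter, decide_eq_true_eq] at hi
    obtain ⟨-, ⟨h₁, h₂⟩, rfl⟩ := hi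
    have := (D.empty_spec i h₁ h₂).2.2.2
    simp [state, this]
  · exact (List.nodup_finRange _).filter _
  · intro j hj
    simp only [starts, List.mem_filter, decide_eq_true_eq] at hj
    obtain ⟨-, -, rfl⟩ := hj
    simp
  · exact (List.nodup_finRange _).filter _
  · intro j hj
    simp only [ends, List.mem_filter, decide_eq_true_eq] at hj
    obtain ⟨-, hr, rfl⟩ := hj
    have := D.weak_spec j hr.1 hr.2
    have hs : j ∉ D.starts (D.U j) := by
      simp only [starts, List.mem_filter, decide_eq_true_eq]
      omega
    simp only [hs, if_false, hr, this.2.1, le_refl, and_self, if_true,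
      Option.some.injEq, List.drop_eq_nil_iff, List.length_take]
    omega
  · rw [hq]
    convert iqExec_deqs D.takers (D.deqs k) _ _ ?_ using 1
    · simp only [state, IQState.mk.injEq, true_and]
      funext j
      by_cases hr : Returned h .weakEmpty j
      · have hw := D.weak_spec j hr.1 hr.2
        simp only [ends, starts, List.mem_filter, List.mem_finRange, hr, true_and,
          decide_eq_true_eq]
        by_cases h₁ : D.U j = k
        · simp only [h₁, if_true, Option.map_none, ite_eq_right_iff]
          omega
        · by_cases h₂ : D.T j = k
          · have h₃ : D.T j < k + 1 ∧ k + 1 ≤ D.U j := by omega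
            simp only [h₁, h₂, h₃, if_true, if_false, Option.map_some]
            rw [D.drop_drop_deqs _ _ hk]
            simp only [and_self, if_true, Nat.lt_succ_self]
          · by_cases h₃ : D.T j < k ∧ k ≤ D.U j
            · have h₄ : D.T j < k + 1 ∧ k + 1 ≤ D.U j := by omega
              simp only [h₁, h₂, h₃, h₄, and_self, if_true, if_false, Option.map_some]
              rw [D.drop_drop_deqs _ _ hk]
            · have h₄ : ¬ (D.T j < k + 1 ∧ k + 1 ≤ D.U j) := by omega
              simp only [h₁, h₂, h₃, h₄, if_false, Option.map_none]
      · simp [ends, starts, hr]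
    · intro x hx
      have hx' : x ∈ D.items.take (D.d D.N) := by
        refine List.take_subset_take_left _ (D.d_mono hk) (List.mem_of_mem_drop hx)
      exact ⟨D.takers_ne_nil hx', (List.nodup_finRange _).filter _, D.takers_card x⟩

theorem exec_range (K : ℕ) (hK : K ≤ D.N) :
    IQExec n ⟨[], fun _ => none⟩ ((List.range K).flatMap D.block) (D.state K) := by
  induction K with
  | zero =>
    have : D.state 0 = ⟨[], fun _ => none⟩ := by simp [state, D.e_zero]
    rw [this]
    exact .nil _
  | succ K ih =>
    rw [List.range_succ, List.flatMap_append]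
    refine .append (ih (by omega)) ?_
    simpa using D.exec_block K hK

theorem time_of_mem_block {k : ℕ} (hk : k < D.N) {ev : IQEvent h.m} (hev : ev ∈ D.block k)
    {i : Fin h.m} (hi : ev.mentions i) : h.inv i < k ∧ ∀ t, h.ret i = some t → k ≤ t := by
  simp only [block, List.mem_append, List.mem_map] at hev
  rcases hev with (((⟨j, hj, rfl⟩ | ⟨j, hj, rfl⟩) | ⟨j, hj, rfl⟩) | ⟨x, hx, rfl⟩) | ⟨x, hx, rfl⟩
  · simp only [IQEvent.mentions, beq_iff_eq] at hi
    subst hi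
    simp only [empties, List.mem_filter, decide_eq_true_eq] at hj
    obtain ⟨-, hr, rfl⟩ := hj
    have := D.empty_spec j hr.1 hr.2
    exact ⟨this.1, this.2.2.1⟩
  · simp only [IQEvent.mentions, beq_iff_eq] at hi
    subst hi
    simp only [starts, List.mem_filter, decide_eq_true_eq] at hj
    obtain ⟨-, hr, rfl⟩ := hj
    have := D.weak_spec j hr.1 hr.2
    exact ⟨this.1, fun t ht => this.2.1.le.trans (this.2.2.2.1 t ht)⟩
  · simp only [IQEvent.mentions, beq_iff_eq] at hi
    subst hi
    simp only [ends, List.mem_filter, decide_eq_true_eq] at hj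
    obtain ⟨-, hr, rfl⟩ := hj
    have := D.weak_spec j hr.1 hr.2
    exact ⟨this.1.trans this.2.1, this.2.2.2.1⟩
  · simp only [IQEvent.mentions, beq_iff_eq] at hi
    subst hi
    rw [enqs, List.mem_drop_take_iff D.nodup (D.e_mono (Nat.le_succ k))] at hx
    exact D.enq_time k hk x hx.1 hx.2
  · simp only [IQEvent.mentions, takers, List.mem_filter, decide_eq_true_eq] at hi
    rw [deqs, List.mem_drop_take_iff D.nodup (D.d_mono (Nat.le_succ k))] at hx
    exact D.deq_time k hk i x hi.2 hx.1 hx.2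

theorem order_of_le {k k' : ℕ} (hkk : k ≤ k') (hk : k < D.N) (hk' : k' < D.N)
    {a b : IQEvent h.m} (ha : a ∈ D.block k) (hb : b ∈ D.block k') {i j : Fin h.m}
    (hi : a.mentions i) (hj : b.mentions j) : ¬ h.precedes j i := by
  rintro ⟨t, ht, hlt⟩
  have h₁ := (D.time_of_mem_block hk ha hi).1
  have h₂ := (D.time_of_mem_block hk' hb hj).2 t ht
  omega

theorem order_events (i j : Fin h.m) (hij : h.precedes i j) (ki kj : Fin D.events.length)
    (hi : (D.events.get ki).mentions i) (hj : (D.events.get kj).mentions j) :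
    (ki : ℕ) < (kj : ℕ) := by
  have hpw : D.events.Pairwise
      (fun a b => ∀ i j, a.mentions i → b.mentions j → ¬ h.precedes j i) := by
    rw [events, List.pairwise_flatMap]
    constructor
    · intro k hk
      rw [List.mem_range] at hk
      exact List.pairwise_of_forall_mem_list
        fun a ha b hb i j hi hj => D.order_of_le le_rfl hk hk ha hb hi hj
    · refine List.pairwise_lt_range.imp_of_mem ?_
      intro k k' hk hk' hlt a ha b hb i j hi hj
      rw [List.mem_range] at hk hk'
      exact D.order_of_le hlt.le hk hk' ha hb hi hj
  by_contra hle
  rw [not_lt] at hle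
  rcases hle.lt_or_eq with hlt | heq
  · exact List.pairwise_iff_get.1 hpw kj ki hlt j i hj hi hij
  · have : kj = ki := Fin.ext heq
    subst this
    have hm := List.get_mem D.events kj
    obtain ⟨k, hk, hm⟩ := List.mem_flatMap.1 hm
    rw [List.mem_range] at hk
    exact D.order_of_le le_rfl hk hk hm hm hj hi hij

theorem opEvents_events (i : Fin h.m) :
    opEvents D.events i = (List.range D.N).flatMap fun k => opEvents (D.block k) i := by
  rw [opEvents, events, List.filter_flatMap]
  rfl

theorem opEvents_block (k : ℕ) (i : Fin h.m) :
    opEvents (D.block k) i =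
      (if Returned h .empty i ∧ D.T i = k then [.deqEmpty i] else []) ++
      (if Returned h .weakEmpty i ∧ D.T i = k then [.deqStart i] else []) ++
      (if Returned h .weakEmpty i ∧ D.U i = k then [.deqWeakEnd i] else []) ++
      opEvents ((D.enqs k).map (fun x => .enq (D.idx x) x)) i ++
      opEvents ((D.deqs k).map (fun x => .deqMulti (D.takers x) x)) i := by
  simp only [opEvents, block, List.filter_append]
  congr 4
  · exact List.filter_map_finRange (fun j => Returned h .empty j ∧ D.T j = k) _ _ i
      fun _ => rfl
  · exact List.filter_map_finRange (fun j => Returned h .weakEmpty j ∧ D.T j = k) _ _ i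
      fun _ => rfl
  · exact List.filter_map_finRange (fun j => Returned h .weakEmpty j ∧ D.U j = k) _ _ i
      fun _ => rfl

theorem enqs_subset {k : ℕ} {x : ℕ} (hx : x ∈ D.enqs k) : x ∈ D.items :=
  List.mem_of_mem_take (List.mem_of_mem_drop hx)

theorem opEvents_enqs_deq (k : ℕ) (i : Fin h.m) (hi : h.op i = .deq) :
    opEvents ((D.enqs k).map (fun x => .enq (D.idx x) x)) i = [] := by
  simp only [opEvents, List.filter_eq_nil_iff, List.mem_map]
  rintro _ ⟨x, hx, rfl⟩
  have := D.op_idx x (D.enqs_subset hx)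
  simp only [IQEvent.mentions, beq_iff_eq]
  rintro rfl
  simp [hi] at this

theorem opEvents_deqs_none (k : ℕ) (i : Fin h.m) (hi : D.dq i = none) :
    opEvents ((D.deqs k).map (fun x => .deqMulti (D.takers x) x)) i = [] := by
  simp only [opEvents, List.filter_eq_nil_iff, List.mem_map]
  rintro _ ⟨x, hx, rfl⟩
  simp [IQEvent.mentions, takers, hi]

theorem opEvents_enqs (k : ℕ) (i : Fin h.m) (x : ℕ) (hi : h.op i = .enq x) :
    opEvents ((D.enqs k).map (fun x => .enq (D.idx x) x)) i =
      if x ∈ D.enqs k then [.enq i x] else [] := by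
  rw [opEvents, List.filter_map_eq_ite (a := x)]
  · by_cases hx : x ∈ D.enqs k
    · have := D.enq_inj _ _ x (D.op_idx x (D.enqs_subset hx)) hi
      simp [this]
    · simp [hx]
  · exact D.nodup.sublist ((List.drop_sublist _ _).trans (List.take_sublist _ _))
  · intro y hy
    have := D.op_idx y (D.enqs_subset hy)
    rw [IQEvent.mentions, Bool.eq_iff_iff, beq_iff_eq, decide_eq_true_eq]
    constructor
    · rintro rfl
      simpa [hi] using this.symm
    · rintro rfl
      exact D.enq_inj _ _ _ this hi

theorem opEvents_deqs (k : ℕ) (i : Fin h.m) (x : ℕ) (hi : D.dq i = some x) :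
    opEvents ((D.deqs k).map (fun x => .deqMulti (D.takers x) x)) i =
      if x ∈ D.deqs k then [.deqMulti (D.takers x) x] else [] := by
  rw [opEvents, List.filter_map_eq_ite (a := x)]
  · exact D.nodup.sublist ((List.drop_sublist _ _).trans (List.take_sublist _ _))
  · intro y hy
    rw [IQEvent.mentions, decide_eq_decide, takers, List.mem_filter]
    simp [hi, eq_comm]

theorem dq_none_of_enq {i : Fin h.m} {x : ℕ} (hi : h.op i = .enq x) : D.dq i = none := by
  rw [Option.eq_none_iff_forall_ne_some]
  intro y hy
  have := (D.dq_spec i y hy).1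
  simp [hi] at this

theorem opEvents_of_enq {i : Fin h.m} {x : ℕ} (hi : h.op i = .enq x) :
    opEvents D.events i = if x ∈ D.items then [.enq i x] else [] := by
  have hb : ∀ k, opEvents (D.block k) i = if x ∈ D.enqs k then [.enq i x] else [] := by
    intro k
    rw [opEvents_block, opEvents_enqs D k i x hi, opEvents_deqs_none D k i (D.dq_none_of_enq hi)]
    simp [Returned, hi]
  simp only [opEvents_events, hb]
  rw [List.flatMap_range_ite (fun k => x ∈ D.enqs k) (fun k => x ∈ D.items.take (D.e k))]
  · simp [D.e_final]
  · simp [D.e_zero]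
  · intro k
    rw [enqs, List.mem_drop_take_iff D.nodup (D.e_mono (Nat.le_succ k))]
    have := List.take_subset_take_left D.items (D.e_mono (Nat.le_succ k)) (a := x)
    tauto
  · intro k
    rw [enqs, List.mem_drop_take_iff D.nodup (D.e_mono (Nat.le_succ k))]
    tauto

theorem opEvents_of_dq {i : Fin h.m} {x : ℕ} (hi : D.dq i = some x) :
    opEvents D.events i = [.deqMulti (D.takers x) x] := by
  obtain ⟨hop, hx, hout⟩ := D.dq_spec i x hi
  have hb : ∀ k, opEvents (D.block k) i =
      if x ∈ D.deqs k then [.deqMulti (D.takers x) x] else [] := by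
    intro k
    rw [opEvents_block, opEvents_enqs_deq D k i hop, opEvents_deqs D k i x hi]
    have h₁ : ¬ Returned h .empty i := fun hr => by simpa using hout _ hr.2
    have h₂ : ¬ Returned h .weakEmpty i := fun hr => by simpa using hout _ hr.2
    simp [h₁, h₂]
  simp only [opEvents_events, hb]
  rw [List.flatMap_range_ite (fun k => x ∈ D.deqs k) (fun k => x ∈ D.items.take (D.d k))]
  · simp [hx]
  · simp [D.d_zero]
  · intro k
    rw [deqs, List.mem_drop_take_iff D.nodup (D.d_mono (Nat.le_succ k))]
    have := List.take_subset_take_left D.items (D.d_mono (Nat.le_succ k)) (a := x)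
    tauto
  · intro k
    rw [deqs, List.mem_drop_take_iff D.nodup (D.d_mono (Nat.le_succ k))]
    tauto

theorem dq_none_of_returned {i : Fin h.m} {r : QueueRes} (hr : Returned h r i)
    (hv : ∀ x, r ≠ .val x) : D.dq i = none := by
  rw [Option.eq_none_iff_forall_ne_some]
  intro y hy
  exact hv y ((D.dq_spec i y hy).2.2 r hr.2)

theorem opEvents_of_empty {i : Fin h.m} (hi : Returned h .empty i) :
    opEvents D.events i = [.deqEmpty i] := by
  have hw : ¬ Returned h .weakEmpty i := fun hr => by simpa [hi.2] using hr.2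
  have hb : ∀ k, opEvents (D.block k) i = if D.T i = k then [.deqEmpty i] else [] := by
    intro k
    rw [opEvents_block, opEvents_enqs_deq D k i hi.1,
      opEvents_deqs_none D k i (D.dq_none_of_returned hi (by simp))]
    simp [hi, hw]
  simp only [opEvents_events, hb]
  rw [List.flatMap_range_ite (fun k => D.T i = k) (fun k => D.T i < k)]
  · simp [(D.empty_spec i hi.1 hi.2).2.1]
  · simp
  · intro k; omega
  · intro k; omega

theorem opEvents_of_weakEmpty {i : Fin h.m} (hi : Returned h .weakEmpty i) :
    opEvents D.events i = [.deqStart i, .deqWeakEnd i] := by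
  have hw : ¬ Returned h .empty i := fun hr => by simpa [hi.2] using hr.2
  have hs := D.weak_spec i hi.1 hi.2
  have hb : ∀ k, opEvents (D.block k) i =
      (if D.T i = k then [.deqStart i] else []) ++ (if D.U i = k then [.deqWeakEnd i] else []) := by
    intro k
    rw [opEvents_block, opEvents_enqs_deq D k i hi.1,
      opEvents_deqs_none D k i (D.dq_none_of_returned hi (by simp))]
    simp [hi, hw]
  simp only [opEvents_events, hb]
  rw [List.flatMap_range_two hs.2.1]
  simp [hs.2.2.1, hs.2.1.trans hs.2.2.1]

theorem opEvents_of_pending {i : Fin h.m} (hop : h.op i = .deq) (hout : h.out i = none)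
    (hdq : D.dq i = none) : opEvents D.events i = [] := by
  have hb : ∀ k, opEvents (D.block k) i = [] := by
    intro k
    rw [opEvents_block, opEvents_enqs_deq D k i hop, opEvents_deqs_none D k i hdq]
    simp [Returned, hout]
  simp [opEvents_events, hb]

/-- The output of an operation in the linearization. -/
def lout (i : Fin h.m) : QueueRes :=
  match h.op i, D.dq i with
  | .enq _, _ => .ok
  | .deq, some x => .val x
  | .deq, none => (h.out i).getD .weakEmpty

theorem intervalLinearizable (D : TimedLinearization n h) : IntervalLinearizable n h := by
  refine ⟨⟨D.events, D.lout, ⟨_, D.exec_range D.N le_rfl⟩, ?_, ?_, ?_, D.order_events⟩⟩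
  · intro i r hr
    rcases hop : h.op i with x | _
    · simp [lout, hop, (D.enq_complete i x r hop hr).1]
    · rcases hdq : D.dq i with _ | x
      · simp [lout, hop, hdq, hr]
      · simp [lout, hop, hdq, (D.dq_spec i x hdq).2.2 r hr]
  · intro i hi
    obtain ⟨r, hr⟩ := Option.isSome_iff_exists.1 hi
    rcases hop : h.op i with x | _
    · simp [D.opEvents_of_enq hop, (D.enq_complete i x r hop hr).2]
    · rcases r with _ | x | _ | _
      · exact absurd hr (D.deq_ne_ok i hop)
      · simp [D.opEvents_of_dq (D.dq_out i x hop hr)]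
      · simp [D.opEvents_of_empty ⟨hop, hr⟩]
      · simp [D.opEvents_of_weakEmpty ⟨hop, hr⟩]
  · intro i
    rcases hop : h.op i with x | _
    · rw [D.opEvents_of_enq hop]
      by_cases hx : x ∈ D.items
      · exact .inr (.inl ⟨x, rfl, by simp [lout, hop], by simp [hx]⟩)
      · exact .inl (by simp [hx])
    · rcases hdq : D.dq i with _ | x
      · rcases hr : h.out i with _ | r
        · exact .inl (D.opEvents_of_pending hop hr hdq)
        · rcases r with _ | x | _ | _
          · exact absurd hr (D.deq_ne_ok i hop)
          · simp [D.dq_out i x hop hr] at hdq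
          · exact .inr (.inr (.inr (.inl
              ⟨rfl, by simp [lout, hop, hdq, hr], D.opEvents_of_empty ⟨hop, hr⟩⟩)))
          · exact .inr (.inr (.inr (.inr (.inl
              ⟨rfl, by simp [lout, hop, hdq, hr], .inr (D.opEvents_of_weakEmpty ⟨hop, hr⟩)⟩))))
      · exact .inr (.inr (.inl ⟨x, D.takers x, rfl, by simp [lout, hop, hdq],
          by simp [takers, hdq], D.opEvents_of_dq hdq⟩))

end TimedLinearization

/-- The presence of items in a shared array over time (`Pr k x`: item `x` is available before
step `k`), together with how the operations of `h` relate to it. -/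
structure PresenceTrace (n : ℕ) (h : ConcHistory QueueOp QueueRes) where
  N : ℕ
  Pr : ℕ → ℕ → Prop
  zero : ∀ x, ¬ Pr 0 x
  add_unique : ∀ k < N, ∀ x y, ¬ Pr k x → Pr (k + 1) x → ¬ Pr k y → Pr (k + 1) y → x = y
  rem_unique : ∀ k < N, ∀ x y, Pr k x → ¬ Pr (k + 1) x → Pr k y → ¬ Pr (k + 1) y → x = y
  no_return : ∀ j k l x, j ≤ k → k ≤ l → l ≤ N → Pr j x → ¬ Pr k x → ¬ Pr l x
  enq_inj : ∀ i j x, h.op i = .enq x → h.op j = .enq x → i = j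
  enq_of_pr : ∀ j ≤ N, ∀ x, Pr j x → ∃ i, h.op i = .enq x
  inv_lt : ∀ i x, h.op i = .enq x → ∀ j ≤ N, Pr j x → h.inv i + 1 < j
  enq_ret : ∀ i x, h.op i = .enq x → ∀ t, h.ret i = some t → ∃ j ≤ t, j ≤ N ∧ Pr j x
  enq_out : ∀ i x r, h.op i = .enq x → h.out i = some r → r = .ok ∧ ∃ j ≤ N, Pr j x
  fifo : ∀ i x, h.op i = .enq x → ∀ k < N, Pr k x → ¬ Pr (k + 1) x →
    ∀ y, ∀ j ≤ h.inv i + 1, Pr j y → ¬ Pr k y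
  dq : Fin h.m → Option ℕ
  dq_spec : ∀ i x, dq i = some x →
    h.op i = .deq ∧ (∀ r, h.out i = some r → r = .val x) ∧
    ∃ a b, h.inv i < a ∧ a ≤ b ∧ b ≤ N ∧ (∀ t, h.ret i = some t → b ≤ t) ∧ Pr a x ∧ ¬ Pr b x
  dq_out : ∀ i x, h.op i = .deq → h.out i = some (.val x) → dq i = some x
  taker : ∀ k < N, ∀ x, Pr k x → ¬ Pr (k + 1) x → ∃ i, dq i = some x
  takers_card : ∀ x, ((List.finRange h.m).filter (fun i => dq i = some x)).length ≤ n
  deq_ne_ok : ∀ i, h.op i = .deq → h.out i ≠ some .ok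
  empty_spec : ∀ i, h.op i = .deq → h.out i = some .empty →
    ∃ T, h.inv i < T ∧ T < N ∧ (∀ t, h.ret i = some t → T ≤ t) ∧ ∀ x, ¬ Pr T x
  weak_spec : ∀ i, h.op i = .deq → h.out i = some .weakEmpty →
    ∃ T U, h.inv i < T ∧ T < U ∧ U < N ∧ (∀ t, h.ret i = some t → U ≤ t) ∧
      ∀ x, ∀ j ≤ T, Pr j x → ¬ Pr U x

namespace PresenceTrace

open Classical in
/-- The list consisting of a witness of `p`, if there is one. -/
noncomputable def witnessList (p : ℕ → Prop) : List ℕ :=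
  if hp : ∃ x, p x then [hp.choose] else []

theorem mem_witnessList {p : ℕ → Prop} (hp : ∀ x y, p x → p y → x = y) (x : ℕ) :
    x ∈ witnessList p ↔ p x := by
  unfold witnessList
  split_ifs with hx
  · rw [List.mem_singleton]
    exact ⟨fun h => h ▸ hx.choose_spec, fun h => hp _ _ h hx.choose_spec⟩
  · simp only [List.not_mem_nil, false_iff]
    exact fun h => hx ⟨x, h⟩

theorem nodup_witnessList (p : ℕ → Prop) : (witnessList p).Nodup := by
  unfold witnessList
  split_ifs <;> simp

variable {n : ℕ} {h : ConcHistory QueueOp QueueRes} (D : PresenceTrace n h)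

/-- The items that appeared before step `k`, in order of appearance. -/
noncomputable def written : ℕ → List ℕ
  | 0 => []
  | k + 1 => written k ++ witnessList fun x => ¬ D.Pr k x ∧ D.Pr (k + 1) x

/-- The items that disappeared before step `k`, in order of disappearance. -/
noncomputable def gone : ℕ → List ℕ
  | 0 => []
  | k + 1 => gone k ++ witnessList fun x => D.Pr k x ∧ ¬ D.Pr (k + 1) x

theorem written_prefix {k l : ℕ} (hkl : k ≤ l) : D.written k <+: D.written l := by
  induction l, hkl using Nat.le_induction with
  | base => exact List.prefix_rfl
  | succ l _ ih => exact ih.trans (List.prefix_append _ _)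

theorem gone_prefix {k l : ℕ} (hkl : k ≤ l) : D.gone k <+: D.gone l := by
  induction l, hkl using Nat.le_induction with
  | base => exact List.prefix_rfl
  | succ l _ ih => exact ih.trans (List.prefix_append _ _)

theorem mem_written {k : ℕ} (hk : k ≤ D.N) (x : ℕ) :
    x ∈ D.written k ↔ ∃ j ≤ k, D.Pr j x := by
  induction k with
  | zero => simp [written, D.zero]
  | succ k ih =>
    rw [written, List.mem_append, ih (by omega), mem_witnessList
      fun x y hx hy => D.add_unique k hk x y hx.1 hx.2 hy.1 hy.2]
    constructor
    · rintro (⟨j, hj, hx⟩ | hx)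
      · exact ⟨j, by omega, hx⟩
      · exact ⟨k + 1, le_rfl, hx.2⟩
    · rintro ⟨j, hj, hx⟩
      rcases hj.lt_or_eq with hj | rfl
      · exact .inl ⟨j, by omega, hx⟩
      · by_cases hx' : D.Pr k x
        · exact .inl ⟨k, le_rfl, hx'⟩
        · exact .inr ⟨hx', hx⟩

theorem mem_gone {k : ℕ} (hk : k ≤ D.N) (x : ℕ) :
    x ∈ D.gone k ↔ x ∈ D.written k ∧ ¬ D.Pr k x := by
  induction k with
  | zero => simp [written, gone]
  | succ k ih =>
    rw [gone, List.mem_append, ih (by omega), mem_witnessList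
      fun x y hx hy => D.rem_unique k hk x y hx.1 hx.2 hy.1 hy.2, D.mem_written (by omega),
      D.mem_written hk]
    constructor
    · rintro (⟨⟨j, hj, hx⟩, hx'⟩ | hx)
      · exact ⟨⟨j, by omega, hx⟩, D.no_return j k (k + 1) x hj (by omega) hk hx hx'⟩
      · exact ⟨⟨k, by omega, hx.1⟩, hx.2⟩
    · rintro ⟨⟨j, hj, hx⟩, hx'⟩
      rcases hj.lt_or_eq with hj | rfl
      · by_cases hx'' : D.Pr k x
        · exact .inr ⟨hx'', hx'⟩
        · exact .inl ⟨⟨j, by omega, hx⟩, hx''⟩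
      · exact absurd hx hx'

theorem nodup_written {k : ℕ} (hk : k ≤ D.N) : (D.written k).Nodup := by
  induction k with
  | zero => simp [written]
  | succ k ih =>
    refine List.Nodup.append (ih (by omega)) (nodup_witnessList _) ?_
    intro x hx hx'
    rw [mem_witnessList fun x y hx hy => D.add_unique k hk x y hx.1 hx.2 hy.1 hy.2] at hx'
    obtain ⟨j, hj, hj'⟩ := (D.mem_written (by omega) x).1 hx
    exact D.no_return j k (k + 1) x hj (by omega) hk hj' hx'.1 hx'.2

theorem nodup_gone {k : ℕ} (hk : k ≤ D.N) : (D.gone k).Nodup := by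
  induction k with
  | zero => simp [gone]
  | succ k ih =>
    refine List.Nodup.append (ih (by omega)) (nodup_witnessList _) ?_
    intro x hx hx'
    rw [mem_witnessList fun x y hx hy => D.rem_unique k hk x y hx.1 hx.2 hy.1 hy.2] at hx'
    exact ((D.mem_gone (by omega) x).1 hx).2 hx'.1

theorem exists_step_of_mem_gone {k : ℕ} (hk : k ≤ D.N) {x : ℕ} (hx : x ∈ D.gone k) :
    ∃ m < k, D.Pr m x ∧ ¬ D.Pr (m + 1) x := by
  induction k with
  | zero => simp [gone] at hx
  | succ k ih =>
    rw [gone, List.mem_append,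
      mem_witnessList fun x y hx hy => D.rem_unique k hk x y hx.1 hx.2 hy.1 hy.2] at hx
    rcases hx with hx | hx
    · obtain ⟨m, hm, h'⟩ := ih (by omega) hx
      exact ⟨m, by omega, h'⟩
    · exact ⟨k, by omega, hx⟩

/-- All items that ever appear: the taken ones in the order in which they are taken, then the
others in the order in which they appear. -/
noncomputable def items : List ℕ :=
  D.gone D.N ++ (D.written D.N).filter (fun x => x ∉ D.gone D.N)

theorem mem_items (x : ℕ) : x ∈ D.items ↔ x ∈ D.written D.N := by
  have := D.mem_gone le_rfl x
  simp only [items, List.mem_append, List.mem_filter, decide_eq_true_eq]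
  tauto

theorem nodup_items : D.items.Nodup := by
  refine List.Nodup.append (D.nodup_gone le_rfl) ((D.nodup_written le_rfl).filter _) ?_
  intro x hx hx'
  simp only [List.mem_filter, decide_eq_true_eq] at hx'
  exact hx'.2 hx

theorem gone_prefix_items {k : ℕ} (hk : k ≤ D.N) : D.gone k <+: D.items :=
  (D.gone_prefix hk).trans (List.prefix_append _ _)

theorem take_gone {k : ℕ} (hk : k ≤ D.N) : D.items.take (D.gone k).length = D.gone k :=
  (List.prefix_iff_eq_take.1 (D.gone_prefix_items hk)).symm

theorem _root_.List.IsPrefix.idxOf_lt {α : Type*} [DecidableEq α] {L M : List α} (hLM : L <+: M)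
    {x y : α} (hy : y ∈ L) (hx : x ∉ L) : M.idxOf y < M.idxOf x := by
  obtain ⟨R, rfl⟩ := hLM
  rw [List.idxOf_append_of_mem hy, List.idxOf_append_of_notMem hx]
  have := List.idxOf_lt_length_of_mem hy
  omega

theorem _root_.List.mem_take_iff_idxOf {α : Type*} [DecidableEq α] {L : List α} {x : α}
    (hx : x ∈ L) (k : ℕ) : x ∈ L.take k ↔ L.idxOf x < k := by
  constructor
  · intro h
    rw [← List.take_append_drop k L, List.idxOf_append_of_mem h]
    have := List.idxOf_lt_length_of_mem h
    rw [List.length_take] at this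
    omega
  · intro h
    rw [List.mem_take_iff_getElem]
    exact ⟨L.idxOf x, by have := List.idxOf_lt_length_of_mem hx; omega, by simp⟩

/-- The length of the shortest prefix of `items` containing everything written before step `k`. -/
noncomputable def enqueued (k : ℕ) : ℕ :=
  (D.written k).toFinset.sup fun y => D.items.idxOf y + 1

theorem lt_enqueued {p k : ℕ} :
    p < D.enqueued k ↔ ∃ y ∈ D.written k, p ≤ D.items.idxOf y := by
  simp [enqueued, Finset.lt_sup_iff]

theorem enqueued_mono : Monotone D.enqueued := fun _ _ hkl =>
  Finset.sup_mono fun x hx => by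
    rw [List.mem_toFinset] at hx ⊢
    exact (D.written_prefix hkl).subset hx

theorem gone_subset_written {k : ℕ} (hk : k ≤ D.N) {x : ℕ} (hx : x ∈ D.gone k) :
    x ∈ D.written k := ((D.mem_gone hk x).1 hx).1

theorem gone_le_enqueued {k : ℕ} (hk : k ≤ D.N) : (D.gone k).length ≤ D.enqueued k := by
  by_contra! hlt
  have hle := (D.gone_prefix_items hk).length_le
  have hx : D.items[D.enqueued k] ∈ D.gone k := by
    rw [← D.take_gone hk]
    exact List.mem_take_iff_getElem.2 ⟨D.enqueued k, by omega, rfl⟩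
  have := D.lt_enqueued.2 ⟨_, D.gone_subset_written hk hx, le_rfl⟩
  rw [D.nodup_items.idxOf_getElem] at this
  exact lt_irrefl _ this

theorem enqueued_final : D.enqueued D.N = D.items.length := by
  apply le_antisymm
  · refine Finset.sup_le fun x hx => ?_
    rw [List.mem_toFinset, ← D.mem_items] at hx
    exact List.idxOf_lt_length_of_mem hx
  · by_contra! hlt
    have := D.lt_enqueued.2 ⟨_, (D.mem_items _).1 (List.getElem_mem hlt), le_rfl⟩
    rw [D.nodup_items.idxOf_getElem] at this
    exact lt_irrefl _ this

theorem enqueued_le {T U : ℕ} (hU : U ≤ D.N) (hTU : T ≤ U)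
    (hx : ∀ x, ∀ j ≤ T, D.Pr j x → ¬ D.Pr U x) : D.enqueued T ≤ (D.gone U).length := by
  by_contra! hlt
  obtain ⟨y, hy, hle⟩ := D.lt_enqueued.1 hlt
  obtain ⟨j, hj, hjy⟩ := (D.mem_written (by omega) y).1 hy
  have hg : y ∈ D.gone U :=
    (D.mem_gone hU y).2 ⟨(D.written_prefix hTU).subset hy, hx y j hj hjy⟩
  have hi := (D.gone_prefix_items hU).subset hg
  rw [← D.take_gone hU, List.mem_take_iff_idxOf hi] at hg
  omega

theorem inv_lt_of_enqueued {k : ℕ} (hk : k < D.N) {x y : ℕ} {i : Fin h.m} (hi : h.op i = .enq x)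
    (hy : y ∈ D.written (k + 1)) (hle : D.items.idxOf x ≤ D.items.idxOf y) : h.inv i < k := by
  by_contra! hlt
  obtain ⟨j, hj, hjy⟩ := (D.mem_written hk y).1 hy
  have hxk : x ∉ D.written (k + 1) := by
    rw [D.mem_written hk]
    rintro ⟨j, hj, hjx⟩
    have := D.inv_lt i x hi j (by omega) hjx
    omega
  by_cases hx : x ∈ D.gone D.N
  · obtain ⟨m, hm, hpr, hpr'⟩ := D.exists_step_of_mem_gone le_rfl hx
    have hinv := D.inv_lt i x hi m hm.le hpr
    have hym := D.fifo i x hi m hm hpr hpr' y j (by omega) hjy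
    have hyg : y ∈ D.gone m :=
      (D.mem_gone hm.le y).2 ⟨(D.mem_written hm.le y).2 ⟨j, by omega, hjy⟩, hym⟩
    have hxg : x ∉ D.gone m := fun hx => ((D.mem_gone hm.le x).1 hx).2 hpr
    have := (D.gone_prefix_items hm.le).idxOf_lt hyg hxg
    omega
  · have hpre : D.gone D.N ++ (D.written (k + 1)).filter (fun x => x ∉ D.gone D.N) <+: D.items :=
      (List.prefix_append_right_inj _).2 ((D.written_prefix hk).filter _)
    have := hpre.idxOf_lt (x := x) (y := y) (by
      simp only [List.mem_append, List.mem_filter, decide_eq_true_eq]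
      tauto) (by
      simp only [List.mem_append, List.mem_filter]
      tauto)
    omega

theorem intervalLinearizable (D : PresenceTrace n h) : IntervalLinearizable n h := by
  classical
  by_cases hm : Nonempty (Fin h.m)
  · have hidx : ∀ x, ∃ i, x ∈ D.items → h.op i = .enq x := by
      intro x
      by_cases hx : x ∈ D.items
      · rw [D.mem_items, D.mem_written le_rfl] at hx
        obtain ⟨j, hj, hjx⟩ := hx
        obtain ⟨i, hi⟩ := D.enq_of_pr j hj x hjx
        exact ⟨i, fun _ => hi⟩
      · exact ⟨hm.some, fun h => absurd h hx⟩
    choose idx hidx using hidx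
    have hT : ∀ i, ∃ T U : ℕ,
        (h.op i = .deq → h.out i = some .empty →
          h.inv i < T ∧ T < D.N ∧ (∀ t, h.ret i = some t → T ≤ t) ∧ ∀ x, ¬ D.Pr T x) ∧
        (h.op i = .deq → h.out i = some .weakEmpty →
          h.inv i < T ∧ T < U ∧ U < D.N ∧ (∀ t, h.ret i = some t → U ≤ t) ∧
            ∀ x, ∀ j ≤ T, D.Pr j x → ¬ D.Pr U x) := by
      intro i
      by_cases h₁ : h.op i = .deq ∧ h.out i = some .empty
      · obtain ⟨T, hT⟩ := D.empty_spec i h₁.1 h₁.2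
        exact ⟨T, 0, fun _ _ => hT, fun _ h₂ => by simp [h₁.2] at h₂⟩
      · by_cases h₂ : h.op i = .deq ∧ h.out i = some .weakEmpty
        · obtain ⟨T, U, hTU⟩ := D.weak_spec i h₂.1 h₂.2
          exact ⟨T, U, fun _ h₁ => by simp [h₂.2] at h₁, fun _ _ => hTU⟩
        · exact ⟨0, 0, fun h h' => absurd ⟨h, h'⟩ h₁, fun h h' => absurd ⟨h, h'⟩ h₂⟩
    choose T U hempty hweak using hT
    have hlen : Monotone fun k => (D.gone k).length := fun _ _ hkl => (D.gone_prefix hkl).length_le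
    refine TimedLinearization.intervalLinearizable
      { N := D.N, items := D.items, e := D.enqueued, d := fun k => (D.gone k).length, idx := idx,
        dq := D.dq, T := T, U := U, nodup := D.nodup_items, e_mono := D.enqueued_mono,
        d_mono := hlen, e_zero := by simp [enqueued, written], d_zero := rfl,
        d_le_e := fun k hk => D.gone_le_enqueued hk, e_final := D.enqueued_final,
        enq_inj := D.enq_inj, op_idx := hidx, enq_time := ?_, enq_complete := ?_, dq_spec := ?_,
        dq_out := D.dq_out, deq_time := ?_, taker := ?_, takers_card := ?_,
        deq_ne_ok := D.deq_ne_ok, empty_spec := ?_, weak_spec := ?_ }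
    · intro k hk x hx hx'
      have hxi := List.mem_of_mem_take hx
      rw [List.mem_take_iff_idxOf hxi] at hx hx'
      obtain ⟨y, hy, hle⟩ := D.lt_enqueued.1 hx
      refine ⟨D.inv_lt_of_enqueued hk (hidx x hxi) hy hle, fun t ht => ?_⟩
      by_contra! hlt
      obtain ⟨j, hj, -, hjx⟩ := D.enq_ret _ x (hidx x hxi) t ht
      exact hx' (D.lt_enqueued.2
        ⟨x, (D.mem_written hk.le x).2 ⟨j, by omega, hjx⟩, le_rfl⟩)
    · intro i x r hop hr
      obtain ⟨h₁, j, hj, hjx⟩ := D.enq_out i x r hop hr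
      exact ⟨h₁, (D.mem_items x).2 ((D.mem_written le_rfl x).2 ⟨j, hj, hjx⟩)⟩
    · intro i x hi
      obtain ⟨h₁, h₂, a, b, ha, hab, hb, -, hpa, hpb⟩ := D.dq_spec i x hi
      refine ⟨h₁, ?_, h₂⟩
      rw [D.take_gone le_rfl, D.mem_gone le_rfl, D.mem_written le_rfl]
      exact ⟨⟨a, by omega, hpa⟩, D.no_return a b D.N x hab hb le_rfl hpa hpb⟩
    · intro k hk i x hi hx hx'
      rw [D.take_gone (by omega)] at hx hx'
      obtain ⟨h₁, h₂, a, b, ha, hab, hb, ht, hpa, hpb⟩ := D.dq_spec i x hi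
      constructor
      · by_contra! hlt
        have := (D.gone_prefix (k := k + 1) (l := a) (by omega)).subset hx
        exact ((D.mem_gone (by omega) x).1 this).2 hpa
      · intro t hret
        by_contra! hlt
        have hbt := ht t hret
        have hxb : x ∈ D.gone b :=
          (D.mem_gone hb x).2 ⟨(D.mem_written hb x).2 ⟨a, hab, hpa⟩, hpb⟩
        exact hx' ((D.gone_prefix (by omega)).subset hxb)
    · intro x hx
      rw [D.take_gone le_rfl] at hx
      obtain ⟨m, hm, hpr, hpr'⟩ := D.exists_step_of_mem_gone le_rfl hx
      exact D.taker m hm x hpr hpr'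
    · intro x
      exact D.takers_card x
    · intro i h₁ h₂
      obtain ⟨ha, hb, hc, hd⟩ := hempty i h₁ h₂
      refine ⟨ha, hb, hc, le_antisymm (D.gone_le_enqueued hb.le) ?_⟩
      exact D.enqueued_le hb.le le_rfl fun x _ _ _ => hd x
    · intro i h₁ h₂
      obtain ⟨ha, hb, hc, hd, he⟩ := hweak i h₁ h₂
      exact ⟨ha, hb, hc, hd, D.enqueued_le hc.le hb.le he⟩
  · have : ∀ i : Fin h.m, False := fun i => hm ⟨i⟩
    exact ⟨⟨[], fun _ => .ok, ⟨_, .nil _⟩, fun i => (this i).elim, fun i => (this i).elim,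
      fun i => (this i).elim, fun i => (this i).elim⟩⟩

end PresenceTrace

theorem Step.frame {n : ℕ} {c c' : Config n} {i j : Fin n} (h : Step c i c') (hj : j ≠ i) :
    c'.proc j = c.proc j ∧ c'.pend j = c.pend j := by
  cases h <;> simp [hj]

theorem Step.time_eq {n : ℕ} {c c' : Config n} {i : Fin n} (h : Step c i c') :
    c'.time = c.time + 1 := by
  cases h <;> rfl

theorem Step.tail_le {n : ℕ} {c c' : Config n} {i : Fin n} (h : Step c i c') :
    c.tail ≤ c'.tail := by
  cases h <;> simp

/-- A measure on control states that decreases with each step of an operation. -/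
def PS.rank (n : ℕ) : PS → ℕ ×ₗ ℕ ×ₗ ℕ ×ₗ ℕ
  | .idle => toLex (0, toLex (0, toLex (0, 0)))
  | .enq1 _ => toLex (5, toLex (0, toLex (0, 0)))
  | .enq2 _ _ => toLex (4, toLex (0, toLex (0, 0)))
  | .enq3 _ _ => toLex (3, toLex (0, toLex (0, 0)))
  | .deqReadTail k _ => toLex (if k = 1 then 6 else 4, toLex (0, toLex (0, 0)))
  | .deqScan k _ _ tl r s => toLex (if k = 1 then 5 else 3, toLex (tl - r, toLex (n - s, 1)))
  | .deqWrite k _ _ tl r s _ => toLex (if k = 1 then 5 else 3, toLex (tl - r, toLex (n - s, 0)))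
  | .done _ => toLex (1, toLex (0, toLex (0, 0)))

theorem Step.rank_lt {n : ℕ} {c c' : Config n} {i : Fin n} (h : Step c i c')
    (hp : c.pend i ≠ none) :
    c'.pend i = none ∨ c'.pend i ≠ none ∧ (c'.proc i).rank n < (c.proc i).rank n := by
  cases h with
  | invEnq x h hp' => exact absurd hp' hp
  | invDeq h hp' => exact absurd hp' hp
  | respond => exact .inl (by simp)
  | _ =>
    right
    refine ⟨hp, ?_⟩
    simp only [Function.update_self, *, PS.rank, Prod.Lex.toLex_lt_toLex, lt_irrefl, false_or,
      true_and]
    first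
    | (split_ifs <;> omega)
    | omega

theorem Run.exists_pend_eq_none {n : ℕ} {c : ℕ → Config n} {sched : ℕ → Fin n} (hr : Run c sched)
    (i : Fin n) (hi : ∀ k, ∃ k' ≥ k, sched k' = i) (k : ℕ) (hk : (c k).pend i ≠ none) :
    ∃ k' > k, (c k').pend i = none := by
  generalize hm : ((c k).proc i).rank n = m
  induction m using WellFoundedLT.induction generalizing k with
  | ind m ih =>
    classical
    have hex : ∃ d, sched (k + d) = i := by
      obtain ⟨k', hk', h⟩ := hi k
      exact ⟨k' - k, by rwa [Nat.add_sub_cancel' hk']⟩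
    have hstay : ∀ d ≤ Nat.find hex,
        (c (k + d)).proc i = (c k).proc i ∧ (c (k + d)).pend i = (c k).pend i := by
      intro d hd
      induction d with
      | zero => simp
      | succ d ihd =>
        have := (hr.2 (k + d)).frame (Ne.symm (Nat.find_min hex (m := d) (by omega)))
        have := ihd (by omega)
        simp_all [← add_assoc]
    obtain ⟨h₁, h₂⟩ := hstay _ le_rfl
    have hstep := hr.2 (k + Nat.find hex)
    rw [Nat.find_spec hex] at hstep
    rcases hstep.rank_lt (by rwa [h₂]) with h | ⟨h₃, h₄⟩
    · exact ⟨_, by omega, h⟩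
    · rw [h₁, hm] at h₄
      obtain ⟨k', hk', h⟩ := ih _ h₄ _ h₃ rfl
      exact ⟨k', by omega, h⟩

/-- Invariants of single configurations relating the control states to the array. -/
structure CellInv {n : ℕ} (c : Config n) : Prop where
  tail_pos : 1 ≤ c.tail
  bounds : ∀ r s, c.items r s ≠ .bot → 1 ≤ r ∧ r < c.tail ∧ 1 ≤ s ∧ s ≤ n
  enq2 : ∀ i x t, c.proc i = .enq2 x t →
    1 ≤ t ∧ t ≤ c.tail ∧ ∀ r, c.items r (i + 1) ≠ .bot → r < t
  enq3 : ∀ i x t, c.proc i = .enq3 x t →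
    1 ≤ t ∧ t < c.tail ∧ ∀ r, c.items r (i + 1) ≠ .bot → r < t
  write : ∀ i k tk1 tk tl r s v, c.proc i = .deqWrite k tk1 tk tl r s v →
    v ≠ .bot ∧ (c.items r s = v ∨ c.items r s = .mark)

theorem CellInv.initial (n : ℕ) : CellInv (initConfig n) := by
  constructor <;> simp [initConfig]

/-- The possible evolutions of an array entry. -/
def Cell.Evolves (a b : Cell) : Prop :=
  a = b ∨ (a = .bot ∧ ∃ x, b = .val x) ∨ ((∃ x, a = .val x) ∧ b = .mark)

theorem CellInv.evolves {n : ℕ} {c c' : Config n} {i : Fin n} (hc : CellInv c)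
    (h : Step c i c') (r s : ℕ) : (c.items r s).Evolves (c'.items r s) := by
  cases h with
  | enqWrite x t h =>
    have := hc.enq3 i x t h
    unfold Cell.Evolves
    by_cases hrs : r = t ∧ s = (i : ℕ) + 1
    · obtain ⟨rfl, rfl⟩ := hrs
      refine .inr (.inl ⟨?_, x, by simp⟩)
      by_contra hb
      exact lt_irrefl _ (this.2.2 _ hb)
    · simp [hrs]
  | deqWrite_val _ _ _ _ r' s' _ h | deqWrite_mark_col _ _ _ _ r' s' h
  | deqWrite_mark_row _ _ _ _ r' s' h | deqWrite_mark_end_scan1 _ _ _ r' s' h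
  | deqWrite_mark_end_scan2 _ _ _ r' s' h =>
    have := (hc.write i _ _ _ _ _ _ _ h).2
    unfold Cell.Evolves
    by_cases hrs : r = r' ∧ s = s'
    · obtain ⟨rfl, rfl⟩ := hrs
      rcases this with h | h <;> simp [h]
    · simp [hrs]
  | _ => exact .inl rfl

theorem CellInv.column {n : ℕ} {c c' : Config n} {i j : Fin n} (hc : CellInv c)
    (h : Step c i c') (hj : j ≠ i) (r : ℕ) (hr : c'.items r (j + 1) ≠ .bot) :
    c.items r (j + 1) ≠ .bot := by
  have hev := hc.evolves h r (j + 1)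
  cases h with
  | enqWrite x t h =>
    have : (j : ℕ) ≠ i := fun h => hj (Fin.ext h)
    simpa [this] using hr
  | deqWrite_val _ _ _ _ r' s' _ h | deqWrite_mark_col _ _ _ _ r' s' h
  | deqWrite_mark_row _ _ _ _ r' s' h | deqWrite_mark_end_scan1 _ _ _ r' s' h
  | deqWrite_mark_end_scan2 _ _ _ r' s' h =>
    intro hb
    have h₁ := hc.write i _ _ _ _ _ _ _ h
    simp only [Cell.Evolves, hb] at hev
    split_ifs at hev hr <;> simp_all
  | _ => exact hr

theorem Cell.Evolves.ne_bot {a b : Cell} (h : a.Evolves b) (ha : a ≠ .bot) : b ≠ .bot := by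
  rcases h with h | h | h <;> simp_all

theorem Cell.Evolves.mark {a b : Cell} (h : a.Evolves b) (ha : a = .mark) : b = .mark := by
  rcases h with h | h | h <;> simp_all

theorem Cell.Evolves.val {a b : Cell} (h : a.Evolves b) {v : Cell} (hv : v ≠ .bot)
    (ha : a = v ∨ a = .mark) : b = v ∨ b = .mark := by
  rcases h with h | h | h <;> simp_all

theorem CellInv.step {n : ℕ} {c c' : Config n} {i : Fin n} (hc : CellInv c) (h : Step c i c') :
    CellInv c' := by
  have htail := h.tail_le
  refine ⟨hc.tail_pos.trans htail, ?_, ?_, ?_, ?_⟩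
  · intro r s hrs
    by_cases hb : c.items r s = .bot
    · cases h with
      | enqWrite x t h =>
        have := hc.enq3 i x t h
        by_cases he : r = t ∧ s = (i : ℕ) + 1
        · obtain ⟨rfl, rfl⟩ := he
          exact ⟨this.1, this.2.1, by omega, i.2⟩
        · simp [he, hb] at hrs
      | deqWrite_val _ _ _ _ r' s' _ h | deqWrite_mark_col _ _ _ _ r' s' h
      | deqWrite_mark_row _ _ _ _ r' s' h | deqWrite_mark_end_scan1 _ _ _ r' s' h
      | deqWrite_mark_end_scan2 _ _ _ r' s' h =>
        have h₁ := hc.write i _ _ _ _ _ _ _ h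
        by_cases he : r = r' ∧ s = s'
        · obtain ⟨rfl, rfl⟩ := he
          simp_all
        · simp [he, hb] at hrs
      | _ => exact absurd hb hrs
    · have := hc.bounds r s hb
      omega
  · intro j x t hj
    by_cases hji : j = i
    · subst hji
      cases h with
      | enqReadTail y h =>
        simp only [Function.update_self, PS.enq2.injEq] at hj
        obtain ⟨rfl, rfl⟩ := hj
        exact ⟨hc.tail_pos, le_rfl, fun r hr => (hc.bounds r _ hr).2.1⟩
      | _ => simp at hj
    · rw [(h.frame hji).1] at hj
      obtain ⟨h₁, h₂, h₃⟩ := hc.enq2 j x t hj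
      exact ⟨h₁, h₂.trans htail, fun r hr => h₃ r (hc.column h hji r hr)⟩
  · intro j x t hj
    by_cases hji : j = i
    · subst hji
      cases h with
      | enqIncTail y t' h =>
        simp only [Function.update_self, PS.enq3.injEq] at hj
        obtain ⟨rfl, rfl⟩ := hj
        obtain ⟨h₁, h₂, h₃⟩ := hc.enq2 j _ _ h
        exact ⟨h₁, by simpa [Nat.lt_succ_iff] using h₂, h₃⟩
      | _ => simp at hj
    · rw [(h.frame hji).1] at hj
      obtain ⟨h₁, h₂, h₃⟩ := hc.enq3 j x t hj
      exact ⟨h₁, h₂.trans_le htail, fun r hr => h₃ r (hc.column h hji r hr)⟩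
  · intro j k tk1 tk tl r s v hj
    by_cases hji : j = i
    · subst hji
      cases h with
      | deqRead_nonbot k' tk1' tk' tl' r' s' v' h hx hv =>
        simp only [Function.update_self, PS.deqWrite.injEq] at hj
        obtain ⟨-, -, -, -, rfl, rfl, rfl⟩ := hj
        exact ⟨hv, .inl hx⟩
      | _ => simp at hj
    · rw [(h.frame hji).1] at hj
      obtain ⟨h₁, h₂⟩ := hc.write j _ _ _ _ _ _ _ hj
      exact ⟨h₁, (hc.evolves h r s).val h₁ h₂⟩

namespace Run

variable {n : ℕ} {c : ℕ → Config n} {sched : ℕ → Fin n}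

theorem cellInv (hr : Run c sched) (k : ℕ) : CellInv (c k) := by
  induction k with
  | zero => exact hr.1 ▸ CellInv.initial n
  | succ k ih => exact ih.step (hr.2 k)

theorem evolves (hr : Run c sched) (k r s : ℕ) :
    ((c k).items r s).Evolves ((c (k + 1)).items r s) := (hr.cellInv k).evolves (hr.2 k) r s

theorem time_eq (hr : Run c sched) (k : ℕ) : (c k).time = k := by
  induction k with
  | zero => rw [hr.1]; rfl
  | succ k ih => rw [(hr.2 k).time_eq, ih]

theorem tail_mono (hr : Run c sched) : Monotone fun k => (c k).tail :=
  monotone_nat_of_le_succ fun k => (hr.2 k).tail_le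

theorem ne_bot_mono (hr : Run c sched) {a b r s : ℕ} (hab : a ≤ b)
    (h : (c a).items r s ≠ .bot) : (c b).items r s ≠ .bot := by
  induction b, hab using Nat.le_induction with
  | base => exact h
  | succ b _ ih => exact (hr.evolves b r s).ne_bot ih

theorem mark_mono (hr : Run c sched) {a b r s : ℕ} (hab : a ≤ b)
    (h : (c a).items r s = .mark) : (c b).items r s = .mark := by
  induction b, hab using Nat.le_induction with
  | base => exact h
  | succ b _ ih => exact (hr.evolves b r s).mark ih

theorem val_mono (hr : Run c sched) {a b r s x : ℕ} (hab : a ≤ b)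
    (h : (c a).items r s = .val x) :
    (c b).items r s = .val x ∨ (c b).items r s = .mark := by
  induction b, hab using Nat.le_induction with
  | base => exact .inl h
  | succ b _ ih => exact (hr.evolves b r s).val (by simp) ih

end Run

/-- The scan order on array entries. -/
def Before (r s : ℕ) (p : ℕ × ℕ) : Prop := p.1 < r ∨ p.1 = r ∧ p.2 < s

/-- At least `m` entries are marked before step `k`. -/
def MarkCount {n : ℕ} (c : ℕ → Config n) (k m : ℕ) : Prop :=
  ∃ S : Finset (ℕ × ℕ), S.card = m ∧ ∀ p ∈ S, (c k).items p.1 p.2 = .mark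

/-- A scan started after step `T` that has covered the entries in `B`, and counted `tk` marked
ones. -/
def ScanPart {n : ℕ} (c : ℕ → Config n) (k T tk : ℕ) (B : ℕ × ℕ → Prop) : Prop :=
  ∃ S : Finset (ℕ × ℕ), S.card = tk ∧ (∀ p ∈ S, B p ∧ (c k).items p.1 p.2 = .mark) ∧
    ∀ p, B p → p ∉ S → (c T).items p.1 p.2 = .bot

/-- The invariant of a scan that is about to deal with the entry `(r, s)`. -/
structure ScanInv {n : ℕ} (c : ℕ → Config n) (k T j tk1 tk tl r s : ℕ) : Prop where
  tail_eq : (c T).tail = tl + 1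
  row_le : r ≤ tl
  number : j = 1 ∨ j = 2 ∧ MarkCount c T tk1
  part : ScanPart c k T tk (Before r s)

/-- Step `w` is the write of item `x` to row `r` by process `i`. -/
def Writes {n : ℕ} (c : ℕ → Config n) (sched : ℕ → Fin n) (w : ℕ) (i : Fin n) (x r : ℕ) : Prop :=
  sched w = i ∧ (c w).proc i = .enq3 x r

/-- What the control state of process `i` before step `k` says about the past of its pending
operation `op`, invoked at step `t₀`. -/
def OpInv {n : ℕ} (c : ℕ → Config n) (sched : ℕ → Fin n) (k : ℕ) (i : Fin n) (op : QueueOp)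
    (t₀ : ℕ) : PS → Prop
  | .idle => False
  | .enq1 x => op = .enq x
  | .enq2 x t => op = .enq x ∧ ∃ a, t₀ < a ∧ a < k ∧ (c a).tail = t
  | .enq3 x t => op = .enq x ∧ ∃ a, t₀ < a ∧ a < k ∧ (c a).tail = t
  | .deqReadTail j tk1 => op = .deq ∧ (j = 1 ∨ j = 2 ∧ MarkCount c k tk1)
  | .deqScan j tk1 tk tl r s => op = .deq ∧ ∃ T, t₀ < T ∧ T < k ∧ ScanInv c k T j tk1 tk tl r s
  | .deqWrite j tk1 tk tl r s v => op = .deq ∧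
      (∃ T, t₀ < T ∧ T < k ∧ ScanInv c k T j tk1 tk tl r s) ∧
      ∃ a, t₀ < a ∧ a < k ∧ (c a).items r s = v
  | .done .ok => ∃ x r w, op = .enq x ∧ t₀ < w ∧ w < k ∧ Writes c sched w i x r
  | .done (.val x) => op = .deq ∧
      ∃ a r s, t₀ < a ∧ a < k ∧ (c a).items r s = .val x ∧ (c k).items r s = .mark
  | .done .empty => op = .deq ∧ ∃ T, t₀ < T ∧ T < k ∧ ∀ r s x, (c T).items r s ≠ .val x
  | .done .weakEmpty => op = .deq ∧
      ∃ T, t₀ < T ∧ T < k ∧ ∀ r s, (c T).items r s ≠ .bot → (c k).items r s = .mark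

section scan

variable {n : ℕ} {c : ℕ → Config n} {sched : ℕ → Fin n}

theorem MarkCount.succ (hr : Run c sched) {k m : ℕ} (h : MarkCount c k m) :
    MarkCount c (k + 1) m := by
  obtain ⟨S, h₁, h₂⟩ := h
  exact ⟨S, h₁, fun p hp => hr.mark_mono (Nat.le_succ k) (h₂ p hp)⟩

theorem ScanPart.succ (hr : Run c sched) {k T tk : ℕ} {B : ℕ × ℕ → Prop}
    (h : ScanPart c k T tk B) : ScanPart c (k + 1) T tk B := by
  obtain ⟨S, h₁, h₂, h₃⟩ := h
  exact ⟨S, h₁, fun p hp => ⟨(h₂ p hp).1, hr.mark_mono (Nat.le_succ k) (h₂ p hp).2⟩, h₃⟩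

theorem ScanInv.succ (hr : Run c sched) {k T j tk1 tk tl r s : ℕ}
    (h : ScanInv c k T j tk1 tk tl r s) : ScanInv c (k + 1) T j tk1 tk tl r s :=
  ⟨h.tail_eq, h.row_le, h.number, h.part.succ hr⟩

theorem ScanPart.mono {k T tk : ℕ} {B B' : ℕ × ℕ → Prop} (h : ScanPart c k T tk B)
    (hB : ∀ p, B p → B' p) (hB' : ∀ p, B' p → (c T).items p.1 p.2 ≠ .bot → B p) :
    ScanPart c k T tk B' := by
  obtain ⟨S, h₁, h₂, h₃⟩ := h
  refine ⟨S, h₁, fun p hp => ⟨hB p (h₂ p hp).1, (h₂ p hp).2⟩, fun p hp hpS => ?_⟩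
  by_contra hb
  exact hb (h₃ p (hB' p hp hb) hpS)

theorem ScanPart.bot (hr : Run c sched) {k T tk r s : ℕ} (hT : T ≤ k)
    (h : ScanPart c k T tk (Before r s)) (hb : (c k).items r s = .bot) :
    ScanPart c k T tk (Before r (s + 1)) := by
  refine h.mono (fun p hp => ?_) fun p hp hpb => ?_
  · simp only [Before] at *; omega
  · have := hr.ne_bot_mono hT hpb
    have : p ≠ (r, s) := by
      rintro rfl
      exact this hb
    rw [Ne, Prod.ext_iff] at this
    simp only [Before] at *; omega

theorem ScanPart.mark {k T tk r s : ℕ} (h : ScanPart c k T tk (Before r s))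
    (hb : (c k).items r s = .mark) : ScanPart c k T (tk + 1) (Before r (s + 1)) := by
  obtain ⟨S, h₁, h₂, h₃⟩ := h
  refine ⟨insert (r, s) S, ?_, ?_, ?_⟩
  · rw [Finset.card_insert_of_notMem, h₁]
    intro hS
    have := (h₂ _ hS).1
    simp [Before] at this
  · intro p hp
    rw [Finset.mem_insert] at hp
    rcases hp with rfl | hp
    · exact ⟨by simp [Before], hb⟩
    · refine ⟨?_, (h₂ p hp).2⟩
      have := (h₂ p hp).1
      simp only [Before] at *; omega
  · intro p hp hpS
    rw [Finset.mem_insert, Prod.ext_iff, not_or] at hpS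
    refine h₃ p ?_ hpS.2
    simp only [Before] at *; omega

theorem ScanPart.row (hr : Run c sched) {k T tk r s : ℕ}
    (h : ScanPart c k T tk (Before r (s + 1))) (hs : n ≤ s) :
    ScanPart c k T tk (Before (r + 1) 1) := by
  refine h.mono (fun p hp => ?_) fun p hp hpb => ?_
  · simp only [Before] at *; omega
  · have := (hr.cellInv T).bounds _ _ hpb
    simp only [Before] at *; omega

theorem ScanPart.full (hr : Run c sched) {k T tk tl r s : ℕ}
    (h : ScanPart c k T tk (Before r (s + 1))) (hs : n ≤ s) (htl : tl ≤ r)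
    (htail : (c T).tail = tl + 1) : ScanPart c k T tk fun _ => True := by
  refine h.mono (fun p hp => trivial) fun p hp hpb => ?_
  have := (hr.cellInv T).bounds _ _ hpb
  simp only [Before] at *; omega

theorem ScanPart.start (hr : Run c sched) (k T : ℕ) : ScanPart c k T 0 (Before 1 1) := by
  refine ⟨∅, rfl, by simp, fun p hp _ => ?_⟩
  by_contra hb
  have := (hr.cellInv T).bounds _ _ hb
  simp only [Before] at *; omega

theorem ScanPart.markCount {k T tk : ℕ} {B : ℕ × ℕ → Prop} (h : ScanPart c k T tk B) :
    MarkCount c k tk := by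
  obtain ⟨S, h₁, h₂, -⟩ := h
  exact ⟨S, h₁, fun p hp => (h₂ p hp).2⟩

theorem ScanPart.mark_of_ne_bot {k T tk : ℕ} {B : ℕ × ℕ → Prop} (h : ScanPart c k T tk B)
    {r s : ℕ} (hB : B (r, s)) (hb : (c T).items r s ≠ .bot) : (c k).items r s = .mark := by
  obtain ⟨S, -, h₂, h₃⟩ := h
  by_cases hS : (r, s) ∈ S
  · exact (h₂ _ hS).2
  · exact absurd (h₃ (r, s) hB hS) hb

theorem ScanPart.ne_val {k T tk : ℕ} (h : ScanPart c k T tk fun _ => True)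
    (hm : MarkCount c T tk) (r s x : ℕ) : (c T).items r s ≠ .val x := by
  intro hx
  obtain ⟨S, h₁, h₂, h₃⟩ := h
  obtain ⟨S', h₁', h₂'⟩ := hm
  have hsub : S' ⊆ S := by
    intro p hp
    by_contra hpS
    have := h₃ p trivial hpS
    simp [h₂' p hp] at this
  have heq := Finset.eq_of_subset_of_card_le hsub (by omega)
  have hmem : (r, s) ∈ S := by
    by_contra hpS
    have := h₃ (r, s) trivial hpS
    simp [hx] at this
  have := h₂' (r, s) (heq ▸ hmem)
  simp [hx] at this

/-- The result of a completed second scan is justified. -/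
theorem OpInv.of_full_scan {i : Fin n} {k T t₀ tk tk1 : ℕ} (hT : t₀ < T) (hTk : T < k)
    (h : ScanPart c k T tk fun _ => True) (hm : MarkCount c T tk1) :
    OpInv c sched k i .deq t₀
      (.done (if tk = tk1 then QueueRes.empty else QueueRes.weakEmpty)) := by
  split_ifs with heq
  · subst heq
    exact ⟨rfl, T, hT, hTk, h.ne_val hm⟩
  · exact ⟨rfl, T, hT, hTk, fun r s hb => h.mark_of_ne_bot trivial hb⟩

theorem OpInv.succ (hr : Run c sched) {k : ℕ} {i : Fin n} {op : QueueOp} {t₀ : ℕ} {p : PS}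
    (h : OpInv c sched k i op t₀ p) : OpInv c sched (k + 1) i op t₀ p := by
  match p, h with
  | .enq1 _, h => exact h
  | .enq2 _ _, ⟨h, a, h₁, h₂, h₃⟩ => exact ⟨h, a, h₁, by omega, h₃⟩
  | .enq3 _ _, ⟨h, a, h₁, h₂, h₃⟩ => exact ⟨h, a, h₁, by omega, h₃⟩
  | .deqReadTail _ _, ⟨h, h'⟩ => exact ⟨h, h'.imp_right fun h' => ⟨h'.1, h'.2.succ hr⟩⟩
  | .deqScan .., ⟨h, T, h₁, h₂, h₃⟩ => exact ⟨h, T, h₁, by omega, h₃.succ hr⟩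
  | .deqWrite .., ⟨h, ⟨T, h₁, h₂, h₃⟩, a, h₄, h₅, h₆⟩ =>
    exact ⟨h, ⟨T, h₁, by omega, h₃.succ hr⟩, a, h₄, by omega, h₆⟩
  | .done .ok, ⟨x, r, w, h, h₁, h₂, h₃⟩ => exact ⟨x, r, w, h, h₁, by omega, h₃⟩
  | .done (.val _), ⟨h, a, r, s, h₁, h₂, h₃, h₄⟩ =>
    exact ⟨h, a, r, s, h₁, by omega, h₃, hr.mark_mono (Nat.le_succ k) h₄⟩
  | .done .empty, ⟨h, T, h₁, h₂, h₃⟩ => exact ⟨h, T, h₁, by omega, h₃⟩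
  | .done .weakEmpty, ⟨h, T, h₁, h₂, h₃⟩ =>
    exact ⟨h, T, h₁, by omega, fun r s hb => hr.mark_mono (Nat.le_succ k) (h₃ r s hb)⟩

end scan

/-- The invariant of process `i` before step `k`. -/
def ProcInv {n : ℕ} (c : ℕ → Config n) (sched : ℕ → Fin n) (k : ℕ) (i : Fin n) : Prop :=
  ((c k).proc i = .idle ∧ (c k).pend i = none) ∨
  ∃ op t₀, (c k).pend i = some (op, t₀) ∧ t₀ < k ∧ OpInv c sched k i op t₀ ((c k).proc i)

namespace Run

variable {n : ℕ} {c : ℕ → Config n} {sched : ℕ → Fin n}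

theorem procInv_step (hr : Run c sched) {k : ℕ} {i : Fin n} (hi : sched k = i)
    (h : ProcInv c sched k i) : ProcInv c sched (k + 1) i := by
  have hstep := hr.2 k
  have htime := hr.time_eq k
  rw [hi] at hstep
  rcases h with ⟨hidle, hpend⟩ | ⟨op, t₀, hpend, ht₀, hop⟩
  · generalize hc' : c (k + 1) = c' at hstep
    cases hstep with
    | invEnq x h hp =>
      refine .inr ⟨.enq x, k, ?_, by omega, ?_⟩ <;> simp [hc', htime, OpInv]
    | invDeq h hp =>
      refine .inr ⟨.deq, k, ?_, by omega, ?_⟩ <;> simp [hc', htime, OpInv]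
    | _ => simp_all
  · have hnext : ∀ p, (c (k + 1)).proc i = p → (c (k + 1)).pend i = (c k).pend i →
        OpInv c sched (k + 1) i op t₀ p → ProcInv c sched (k + 1) i := by
      rintro p rfl h₂ h₃
      exact .inr ⟨op, t₀, by rw [h₂, hpend], by omega, h₃⟩
    have hcell := hr.cellInv k
    have hcell' := hr.cellInv (k + 1)
    have hmark : ∀ {j tk1 tk tl r s}, (c k).proc i = .deqWrite j tk1 tk tl r s .mark →
        (c (k + 1)).items r s = .mark := by
      intro j tk1 tk tl r s h
      have := (hcell.write i _ _ _ _ _ _ _ h).2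
      exact hr.mark_mono (Nat.le_succ k) (by simpa using this)
    have hempty : (c k).tail ≤ 1 → ∀ r s, (c k).items r s = .bot := by
      intro ht r s
      by_contra hb
      have := hcell.bounds r s hb
      omega
    generalize hc' : c (k + 1) = c' at hstep
    cases hstep with
    | invEnq x h hp => simp [hpend] at hp
    | invDeq h hp => simp [hpend] at hp
    | respond res op' t h hp => exact .inl (by simp [hc'])
    | enqReadTail x h =>
      rw [h] at hop
      exact hnext (.enq2 x (c k).tail) (by simp [hc']) (by simp [hc'])
        ⟨hop, k, ht₀, by omega, rfl⟩
    | enqIncTail x t h =>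
      rw [h] at hop
      exact hnext (.enq3 x t) (by simp [hc']) (by simp [hc'])
        (OpInv.succ (p := .enq2 x t) hr hop)
    | enqWrite x t h =>
      rw [h] at hop
      exact hnext (.done .ok) (by simp [hc']) (by simp [hc'])
        ⟨x, t, k, hop.1, ht₀, by omega, hi, h⟩
    | deqReadTail_pos j tk1 h ht =>
      rw [h] at hop
      exact hnext (.deqScan j tk1 0 ((c k).tail - 1) 1 1) (by simp [hc']) (by simp [hc'])
        ⟨hop.1, k, ht₀, by omega, by omega, by omega, hop.2, ScanPart.start hr _ _⟩
    | deqReadTail_zero_scan1 tk1 h ht =>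
      rw [h] at hop
      exact hnext (.deqReadTail 2 0) (by simp [hc']) (by simp [hc'])
        ⟨hop.1, .inr ⟨rfl, ∅, rfl, by simp⟩⟩
    | deqReadTail_zero_scan2 tk1 h ht =>
      rw [h] at hop
      refine hnext (.done (if tk1 = 0 then .empty else .weakEmpty)) (by simp [hc'])
        (by simp [hc']) ?_
      have he := hempty ht
      split_ifs
      · exact ⟨hop.1, k, ht₀, by omega, by simp [he]⟩
      · exact ⟨hop.1, k, ht₀, by omega, by simp [he]⟩
    | deqRead_bot_col j tk1 tk tl r s h hx hs =>
      rw [h] at hop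
      obtain ⟨hop, T, hT, hTk, hsc⟩ := hop
      exact hnext (.deqScan j tk1 tk tl r (s + 1)) (by simp [hc']) (by simp [hc'])
        ⟨hop, T, hT, by omega, hsc.tail_eq, hsc.row_le, hsc.number,
          (hsc.part.bot hr hTk.le hx).succ hr⟩
    | deqRead_bot_row j tk1 tk tl r s h hx hs hrow =>
      rw [h] at hop
      obtain ⟨hop, T, hT, hTk, hsc⟩ := hop
      exact hnext (.deqScan j tk1 tk tl (r + 1) 1) (by simp [hc']) (by simp [hc'])
        ⟨hop, T, hT, by omega, hsc.tail_eq, hrow, hsc.number,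
          ((hsc.part.bot hr hTk.le hx).row hr hs).succ hr⟩
    | deqRead_bot_end_scan1 tk1 tk tl r s h hx hs hrow =>
      rw [h] at hop
      obtain ⟨hop, T, hT, hTk, hsc⟩ := hop
      exact hnext (.deqReadTail 2 tk) (by simp [hc']) (by simp [hc'])
        ⟨hop, .inr ⟨rfl, (hsc.part.succ hr).markCount⟩⟩
    | deqRead_bot_end_scan2 tk1 tk tl r s h hx hs hrow =>
      rw [h] at hop
      obtain ⟨rfl, T, hT, hTk, hsc⟩ := hop
      exact hnext (.done (if tk = tk1 then .empty else .weakEmpty)) (by simp [hc'])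
        (by simp [hc']) (OpInv.of_full_scan hT (by omega)
          (((hsc.part.bot hr hTk.le hx).full hr hs hrow hsc.tail_eq).succ hr)
          (hsc.number.resolve_left (by omega)).2)
    | deqRead_nonbot j tk1 tk tl r s v h hx hv =>
      rw [h] at hop
      obtain ⟨hop, T, hT, hTk, hsc⟩ := hop
      exact hnext (.deqWrite j tk1 tk tl r s v) (by simp [hc']) (by simp [hc'])
        ⟨hop, ⟨T, hT, by omega, hsc.succ hr⟩, k, ht₀, by omega, hx⟩
    | deqWrite_val j tk1 tk tl r s x h =>
      rw [h] at hop
      obtain ⟨hop, -, a, ha, hak, hx⟩ := hop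
      exact hnext (.done (.val x)) (by simp [hc']) (by simp [hc'])
        ⟨hop, a, r, s, ha, by omega, hx, by simp [hc']⟩
    | deqWrite_mark_col j tk1 tk tl r s h hs =>
      have hm := hmark h
      rw [h] at hop
      obtain ⟨hop, ⟨T, hT, hTk, hsc⟩, -⟩ := hop
      exact hnext (.deqScan j tk1 (tk + 1) tl r (s + 1)) (by simp [hc']) (by simp [hc'])
        ⟨hop, T, hT, by omega, hsc.tail_eq, hsc.row_le, hsc.number, (hsc.part.succ hr).mark hm⟩
    | deqWrite_mark_row j tk1 tk tl r s h hs hrow =>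
      have hm := hmark h
      rw [h] at hop
      obtain ⟨hop, ⟨T, hT, hTk, hsc⟩, -⟩ := hop
      exact hnext (.deqScan j tk1 (tk + 1) tl (r + 1) 1) (by simp [hc']) (by simp [hc'])
        ⟨hop, T, hT, by omega, hsc.tail_eq, hrow, hsc.number,
          ((hsc.part.succ hr).mark hm).row hr hs⟩
    | deqWrite_mark_end_scan1 tk1 tk tl r s h hs hrow =>
      have hm := hmark h
      rw [h] at hop
      obtain ⟨hop, ⟨T, hT, hTk, hsc⟩, -⟩ := hop
      exact hnext (.deqReadTail 2 (tk + 1)) (by simp [hc']) (by simp [hc'])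
        ⟨hop, .inr ⟨rfl, ((hsc.part.succ hr).mark hm).markCount⟩⟩
    | deqWrite_mark_end_scan2 tk1 tk tl r s h hs hrow =>
      have hm := hmark h
      rw [h] at hop
      obtain ⟨rfl, ⟨T, hT, hTk, hsc⟩, -⟩ := hop
      exact hnext (.done (if tk + 1 = tk1 then .empty else .weakEmpty)) (by simp [hc'])
        (by simp [hc']) (OpInv.of_full_scan hT (by omega)
          (((hsc.part.succ hr).mark hm).full hr hs hrow hsc.tail_eq)
          (hsc.number.resolve_left (by omega)).2)

theorem procInv (hr : Run c sched) (k : ℕ) (i : Fin n) : ProcInv c sched k i := by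
  induction k with
  | zero => exact .inl (by simp [hr.1, initConfig])
  | succ k ih =>
    by_cases hi : sched k = i
    · exact hr.procInv_step hi ih
    · obtain ⟨h₁, h₂⟩ := (hr.2 k).frame (Ne.symm hi)
      rcases ih with ih | ⟨op, t₀, h₃, h₄, h₅⟩
      · exact .inl (by rwa [h₁, h₂])
      · refine .inr ⟨op, t₀, by rwa [h₂], by omega, ?_⟩
        rw [h₁]
        exact h₅.succ hr

end Run

theorem Step.pend_eq_or_respond {n : ℕ} {c c' : Config n} {i : Fin n} {v : QueueOp × ℕ}
    (h : Step c i c') (hv : c.pend i = some v) :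
    c'.pend i = some v ∧ c'.log = c.log ∨
    ∃ res, c.proc i = .done res ∧ c'.pend i = none ∧
      c'.log = c.log ++ [⟨i, v.1, res, v.2, c.time⟩] := by
  cases h with
  | invEnq _ _ hp | invDeq _ hp => simp [hv] at hp
  | respond res op t₀ h hp =>
    obtain rfl : v = (op, t₀) := by simpa [hv] using hp
    exact .inr ⟨res, h, by simp, rfl⟩
  | _ => exact .inl ⟨hv, rfl⟩

theorem Step.pend_of_none {n : ℕ} {c c' : Config n} {i : Fin n}
    (h : Step c i c') (hv : c.pend i = none) :
    c'.log = c.log ∧ ∀ v, c'.pend i = some v → v.2 = c.time := by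
  cases h <;> simp_all

theorem Step.proc_done {n : ℕ} {c c' : Config n} {i : Fin n} {res : QueueRes}
    (h : Step c i c') (hres : c.proc i = .done res) : c'.pend i = none := by
  cases h <;> simp_all

theorem Step.write_of_val {n : ℕ} {c c' : Config n} {i : Fin n} {r s x : ℕ}
    (h : Step c i c') (h₁ : c.items r s ≠ .val x) (h₂ : c'.items r s = .val x) :
    c.proc i = .enq3 x r ∧ s = i + 1 := by
  cases h with
  | enqWrite y t h =>
    simp only at h₂
    split_ifs at h₂ with hrs
    · obtain ⟨rfl, rfl⟩ := hrs
      simp_all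
    · exact absurd h₂ h₁
  | deqWrite_val | deqWrite_mark_col | deqWrite_mark_row | deqWrite_mark_end_scan1
  | deqWrite_mark_end_scan2 =>
    simp only at h₂
    split_ifs at h₂
    exact absurd h₂ h₁
  | _ => exact absurd h₂ h₁

theorem CellInv.take_of_val {n : ℕ} {c c' : Config n} {i : Fin n} {r s x : ℕ} (hc : CellInv c)
    (h : Step c i c') (h₁ : c.items r s = .val x) (h₂ : c'.items r s ≠ .val x) :
    (∃ j tk1 tk tl, c.proc i = .deqWrite j tk1 tk tl r s (.val x)) ∧
      c'.proc i = .done (.val x) := by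
  cases h with
  | enqWrite y t h =>
    have := (hc.enq3 i y t h).2.2 t
    by_cases hrs : r = t ∧ s = (i : ℕ) + 1
    · obtain ⟨rfl, rfl⟩ := hrs
      simp [h₁] at this
    · simp [hrs, h₁] at h₂
  | deqWrite_val _ _ _ _ r' s' y h =>
    have := (hc.write i _ _ _ _ _ _ _ h).2
    by_cases hrs : r = r' ∧ s = s'
    · obtain ⟨rfl, rfl⟩ := hrs
      obtain rfl : x = y := by simpa [h₁] using this
      exact ⟨⟨_, _, _, _, h⟩, by simp⟩
    · simp [hrs, h₁] at h₂
  | deqWrite_mark_col _ _ _ _ r' s' h | deqWrite_mark_row _ _ _ _ r' s' h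
  | deqWrite_mark_end_scan1 _ _ _ r' s' h | deqWrite_mark_end_scan2 _ _ _ r' s' h =>
    have := (hc.write i _ _ _ _ _ _ _ h).2
    by_cases hrs : r = r' ∧ s = s'
    · obtain ⟨rfl, rfl⟩ := hrs
      simp [h₁] at this
    · simp [hrs, h₁] at h₂
  | _ => exact absurd h₁ h₂

namespace Run

variable {n : ℕ} {c : ℕ → Config n} {sched : ℕ → Fin n}

theorem pend_spec (hr : Run c sched) {k : ℕ} {p : Fin n} {v : QueueOp × ℕ}
    (h : (c k).pend p = some v) :
    v.2 < k ∧ sched v.2 = p ∧ ∀ l, v.2 < l → l ≤ k → (c l).pend p = some v := by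
  induction k with
  | zero => simp [hr.1, initConfig] at h
  | succ k ih =>
    have hold : (c k).pend p = some v → v.2 < k + 1 ∧ sched v.2 = p ∧
        ∀ l, v.2 < l → l ≤ k + 1 → (c l).pend p = some v := by
      intro hk
      obtain ⟨h₁, h₂, h₃⟩ := ih hk
      refine ⟨by omega, h₂, fun l hl hlk => ?_⟩
      rcases hlk.lt_or_eq with hlk | rfl
      · exact h₃ l hl (by omega)
      · exact h
    have hstep := hr.2 k
    by_cases hp : sched k = p
    · rw [hp] at hstep
      cases hk : (c k).pend p with
      | none =>
        have := (hstep.pend_of_none hk).2 v h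
        rw [hr.time_eq] at this
        refine ⟨by omega, this ▸ hp, fun l hl hlk => ?_⟩
        obtain rfl : l = k + 1 := by omega
        exact h
      | some u =>
        rcases hstep.pend_eq_or_respond hk with ⟨h₁, -⟩ | ⟨_, -, h₁, -⟩
        · rw [h₁, Option.some.injEq] at h
          exact hold (h ▸ hk)
        · simp [h₁] at h
    · rw [(hstep.frame (Ne.symm hp)).2] at h
      exact hold h

theorem pend_unique (hr : Run c sched) {k l : ℕ} {p q : Fin n} {v w : QueueOp × ℕ}
    (hv : (c k).pend p = some v) (hw : (c l).pend q = some w) (h : v.2 = w.2) :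
    p = q ∧ v = w := by
  obtain ⟨h₁, h₂, h₃⟩ := hr.pend_spec hv
  obtain ⟨h₄, h₅, h₆⟩ := hr.pend_spec hw
  have hpq : p = q := by rw [← h₂, ← h₅, h]
  have := h₃ (v.2 + 1) (by omega) h₁
  rw [hpq, h₆ (v.2 + 1) (by omega) (by omega), Option.some.injEq] at this
  exact ⟨hpq, this.symm⟩

theorem done_mono (hr : Run c sched) {k l : ℕ} (hkl : k ≤ l) {p : Fin n} {v : QueueOp × ℕ}
    {res : QueueRes} (hv : v.2 < k) (hl : (c l).pend p = some v)
    (h : (c k).proc p = .done res) : (c l).proc p = .done res := by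
  induction l, hkl using Nat.le_induction with
  | base => exact h
  | succ l hkl ih =>
    have hstep := hr.2 l
    have hl' := (hr.pend_spec hl).2.2 l (by omega) (by omega)
    by_cases hp : sched l = p
    · rw [hp] at hstep
      simp [hstep.proc_done (ih hl')] at hl
    · rw [(hstep.frame (Ne.symm hp)).1]
      exact ih hl'

/-- The entries of the log of `c k` are justified by the past of the run. -/
theorem log_spec (hr : Run c sched) (k : ℕ) :
    (∀ e ∈ (c k).log, e.retT < k ∧ (c e.retT).pend e.proc = some (e.op, e.invT) ∧
      (c e.retT).proc e.proc = .done e.res ∧ (c (e.retT + 1)).pend e.proc = none) ∧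
    (c k).log.Pairwise fun e e' => e.retT < e'.retT := by
  induction k with
  | zero => simp [hr.1, initConfig]
  | succ k ih =>
    have hstep := hr.2 k
    have hold : (c (k + 1)).log = (c k).log →
        (∀ e ∈ (c (k + 1)).log, e.retT < k + 1 ∧
          (c e.retT).pend e.proc = some (e.op, e.invT) ∧
          (c e.retT).proc e.proc = .done e.res ∧ (c (e.retT + 1)).pend e.proc = none) ∧
        (c (k + 1)).log.Pairwise fun e e' => e.retT < e'.retT := by
      intro h
      rw [h]
      exact ⟨fun e he => ⟨(ih.1 e he).1.trans (Nat.lt_succ_self k), (ih.1 e he).2⟩, ih.2⟩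
    cases hk : (c k).pend (sched k) with
    | none => exact hold (hstep.pend_of_none hk).1
    | some v =>
      rcases hstep.pend_eq_or_respond hk with ⟨-, h⟩ | ⟨res, h₁, h₂, h₃⟩
      · exact hold h
      · rw [h₃, hr.time_eq]
        refine ⟨fun e he => ?_, ?_⟩
        · rw [List.mem_append, List.mem_singleton] at he
          rcases he with he | rfl
          · exact ⟨(ih.1 e he).1.trans (Nat.lt_succ_self k), (ih.1 e he).2⟩
          · exact ⟨Nat.lt_succ_self k, hk, h₁, h₂⟩
        · rw [List.pairwise_append]
          refine ⟨ih.2, List.pairwise_singleton _ _, fun e he e' he' => ?_⟩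
          rw [List.mem_singleton] at he'
          subst he'
          exact (ih.1 e he).1

/-- An operation pending before step `k` is still pending later on, or has been logged. -/
theorem pend_or_log (hr : Run c sched) {k l : ℕ} (hkl : k ≤ l) {p : Fin n} {v : QueueOp × ℕ}
    (h : (c k).pend p = some v) :
    (c l).pend p = some v ∨ ∃ e ∈ (c l).log, e.op = v.1 ∧ e.invT = v.2 ∧ k ≤ e.retT := by
  induction l, hkl using Nat.le_induction with
  | base => exact .inl h
  | succ l hkl ih =>
    have hstep := hr.2 l
    have hlog : ∀ e ∈ (c l).log, e ∈ (c (l + 1)).log := by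
      intro e he
      cases hs : (c l).pend (sched l) with
      | none => rwa [(hstep.pend_of_none hs).1]
      | some u =>
        rcases hstep.pend_eq_or_respond hs with ⟨-, h'⟩ | ⟨_, -, -, h'⟩ <;> rw [h']
        · exact he
        · exact List.mem_append_left _ he
    rcases ih with ih | ⟨e, he, h'⟩
    · by_cases hp : sched l = p
      · rw [hp] at hstep
        rcases hstep.pend_eq_or_respond ih with ⟨h', -⟩ | ⟨res, -, -, h'⟩
        · exact .inl h'
        · right
          rw [h', hr.time_eq]
          exact ⟨_, List.mem_append_right _ (List.mem_singleton_self _), rfl, rfl, hkl⟩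
      · exact .inl (by rwa [(hstep.frame (Ne.symm hp)).2])
    · exact .inr ⟨e, hlog e he, h'⟩

end Run

section history

variable {n : ℕ}

theorem historyAt_cases (cfg : Config n) (i : Fin (historyAt cfg).m) :
    (∃ j : Fin cfg.log.length, (j : ℕ) = i ∧ (historyAt cfg).op i = (cfg.log.get j).op ∧
      (historyAt cfg).inv i = (cfg.log.get j).invT ∧
      (historyAt cfg).ret i = some (cfg.log.get j).retT ∧
      (historyAt cfg).out i = some (cfg.log.get j).res) ∨
    ∃ j : Fin (pendingList cfg).length, cfg.log.length + j = i ∧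
      ((historyAt cfg).op i, (historyAt cfg).inv i) = (pendingList cfg).get j ∧
      (historyAt cfg).ret i = none ∧ (historyAt cfg).out i = none := by
  by_cases hi : (i : ℕ) < cfg.log.length
  · exact .inl ⟨⟨i, hi⟩, rfl, by simp [historyAt, hi]⟩
  · have := i.2
    have hlen : (i : ℕ) - cfg.log.length < (pendingList cfg).length := by
      simp only [historyAt] at this
      omega
    refine .inr ⟨⟨i - cfg.log.length, hlen⟩, ?_, ?_⟩
    · simp only; omega
    · simp [historyAt, hi, hlen]

theorem historyAt_of_log (cfg : Config n) {e : LogEntry n} (he : e ∈ cfg.log) :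
    ∃ i, (historyAt cfg).op i = e.op ∧ (historyAt cfg).inv i = e.invT ∧
      (historyAt cfg).ret i = some e.retT := by
  obtain ⟨j, rfl⟩ := List.get_of_mem he
  refine ⟨⟨j, by have := j.2; simp only [historyAt]; omega⟩, ?_⟩
  simp [historyAt]

theorem historyAt_of_pend (cfg : Config n) {p : Fin n} {v : QueueOp × ℕ}
    (h : cfg.pend p = some v) :
    ∃ i, (historyAt cfg).op i = v.1 ∧ (historyAt cfg).inv i = v.2 ∧
      (historyAt cfg).ret i = none := by
  have hv : v ∈ pendingList cfg := List.mem_filterMap.2 ⟨p, List.mem_finRange p, h⟩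
  obtain ⟨j, rfl⟩ := List.get_of_mem hv
  refine ⟨⟨cfg.log.length + j, by have := j.2; simp only [historyAt]; omega⟩, ?_⟩
  simp [historyAt]

end history

/-- How the operations of a history relate to the run it comes from, up to step `N`. -/
structure Tracks {n : ℕ} (c : ℕ → Config n) (sched : ℕ → Fin n) (N : ℕ)
    (h : ConcHistory QueueOp QueueRes) : Prop where
  ret_lt : ∀ i t, h.ret i = some t → t < N
  out : ∀ i r, h.out i = some r → ∃ t, h.ret i = some t ∧ (c t).proc (sched (h.inv i)) = .done r
  ret : ∀ i t, h.ret i = some t → ∃ r, (c t).proc (sched (h.inv i)) = .done r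
  pend : ∀ i, (c ((h.ret i).getD N)).pend (sched (h.inv i)) = some (h.op i, h.inv i)
  complete : ∀ k ≤ N, ∀ p v, (c k).pend p = some v →
    ∃ i, h.op i = v.1 ∧ h.inv i = v.2 ∧ k ≤ (h.ret i).getD N
  inj : ∀ i j, h.inv i = h.inv j → i = j

theorem Run.tracks {n : ℕ} {c : ℕ → Config n} {sched : ℕ → Fin n} (hr : Run c sched) (N : ℕ) :
    Tracks c sched N (historyAt (c N)) := by
  obtain ⟨hlog, hsorted⟩ := hr.log_spec N
  have hproc : ∀ e ∈ (c N).log, sched e.invT = e.proc := fun e he =>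
    (hr.pend_spec (hlog e he).2.1).2.1
  have hpend : ∀ v ∈ pendingList (c N), (c N).pend (sched v.2) = some v := by
    intro v hv
    obtain ⟨p, -, hp⟩ := List.mem_filterMap.1 hv
    rwa [(hr.pend_spec hp).2.1]
  have hnodup : (pendingList (c N)).Nodup := by
    refine List.Nodup.filterMap (fun p q v hp hq => ?_) (List.nodup_finRange n)
    rw [← (hr.pend_spec hp).2.1, ← (hr.pend_spec hq).2.1]
  have hearly : ∀ e ∈ (c N).log, ∀ k p v, (c k).pend p = some v → e.retT < k →
      e.invT ≠ v.2 := by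
    intro e he k p v hk hlt heq
    obtain ⟨-, h₁, -, h₂⟩ := hlog e he
    obtain ⟨rfl, rfl⟩ := hr.pend_unique h₁ hk heq
    have := (hr.pend_spec hk).2.2 (e.retT + 1) (by have := (hr.pend_spec h₁).1; omega) hlt
    simp [h₂] at this
  refine ⟨fun i t hi => ?_, fun i r hi => ?_, fun i t hi => ?_, fun i => ?_,
    fun k hk p v hv => ?_, ?_⟩
  · obtain ⟨j, -, -, -, h₁, -⟩ | ⟨j, -, -, h₁, -⟩ := historyAt_cases (c N) i
    · rw [h₁, Option.some.injEq] at hi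
      exact hi ▸ (hlog _ (List.get_mem _ j)).1
    · simp [h₁] at hi
  · obtain ⟨j, -, -, h₀, h₁, h₂⟩ | ⟨j, -, -, -, h₁⟩ := historyAt_cases (c N) i
    · rw [h₂, Option.some.injEq] at hi
      have hj := List.get_mem _ j
      exact ⟨_, h₁, by rw [h₀, hproc _ hj, ← hi]; exact (hlog _ hj).2.2.1⟩
    · simp [h₁] at hi
  · obtain ⟨j, -, -, h₀, h₁, -⟩ | ⟨j, -, -, h₁, -⟩ := historyAt_cases (c N) i
    · rw [h₁, Option.some.injEq] at hi
      have hj := List.get_mem _ j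
      exact ⟨_, by rw [h₀, hproc _ hj, ← hi]; exact (hlog _ hj).2.2.1⟩
    · simp [h₁] at hi
  · obtain ⟨j, -, h₀, h₁, h₂, -⟩ | ⟨j, -, h₀, h₁, -⟩ := historyAt_cases (c N) i
    · have hj := List.get_mem _ j
      rw [h₀, h₁, h₂, hproc _ hj]
      exact (hlog _ hj).2.1
    · rw [h₁, h₀]
      have := hpend _ (List.get_mem _ j)
      rw [← h₀] at this ⊢
      exact this
  · rcases hr.pend_or_log hk hv with h | ⟨e, he, h₁, h₂, h₃⟩
    · obtain ⟨i, h₁, h₂, h₃⟩ := historyAt_of_pend _ h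
      exact ⟨i, h₁, h₂, by simpa [h₃] using hk⟩
    · obtain ⟨i, h₄, h₅, h₆⟩ := historyAt_of_log _ he
      exact ⟨i, h₄.trans h₁, h₅.trans h₂, by simpa [h₆] using h₃⟩
  · have hmixed : ∀ (a : Fin (c N).log.length) (b : Fin (pendingList (c N)).length),
        ((c N).log.get a).invT ≠ ((pendingList (c N)).get b).2 := fun a b =>
      hearly _ (List.get_mem _ a) N _ _ (hpend _ (List.get_mem _ b))
        (hlog _ (List.get_mem _ a)).1
    have hlogs : ∀ a b : Fin (c N).log.length, a < b →
        ((c N).log.get a).invT ≠ ((c N).log.get b).invT := fun a b hab =>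
      hearly _ (List.get_mem _ a) _ _ _ (hlog _ (List.get_mem _ b)).2.1
        (List.pairwise_iff_get.1 hsorted a b hab)
    intro i j hij
    obtain ⟨a, ha, -, ha', -⟩ | ⟨a, ha, ha', -⟩ := historyAt_cases (c N) i <;>
      obtain ⟨b, hb, -, hb', -⟩ | ⟨b, hb, hb', -⟩ := historyAt_cases (c N) j
    · rw [ha', hb'] at hij
      rcases lt_trichotomy a b with hab | rfl | hab
      · exact absurd hij (hlogs a b hab)
      · exact Fin.ext (ha.symm.trans hb)
      · exact absurd hij.symm (hlogs b a hab)
    · exact absurd (by rw [← ha', ← hb', hij]) (hmixed a b)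
    · exact absurd (by rw [← ha', ← hb', hij]) (hmixed b a)
    · have hab : (pendingList (c N)).get a = (pendingList (c N)).get b := by
        refine (hr.pend_unique (hpend _ (List.get_mem _ a)) (hpend _ (List.get_mem _ b)) ?_).2
        rw [← ha', ← hb', hij]
      obtain rfl := hnodup.injective_get hab
      exact Fin.ext (ha.symm.trans hb)

/-- The item that a finished process is about to return. -/
def PS.item : PS → Option ℕ
  | .done (.val x) => some x
  | _ => none

theorem PS.item_eq_some_iff {p : PS} {x : ℕ} : p.item = some x ↔ p = .done (.val x) := by
  unfold PS.item
  split <;> simp_all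

/-- Item `x` is in the array before step `k`. -/
def Present {n : ℕ} (c : ℕ → Config n) (k x : ℕ) : Prop := ∃ r s, (c k).items r s = .val x

/-- Up to step `N`, every item is enqueued by at most one operation. -/
def EnqueuedOnce {n : ℕ} (c : ℕ → Config n) (N : ℕ) : Prop :=
  ∀ k ≤ N, ∀ l ≤ N, ∀ p q x t u, (c k).pend p = some (.enq x, t) →
    (c l).pend q = some (.enq x, u) → t = u

namespace Run

variable {n : ℕ} {c : ℕ → Config n} {sched : ℕ → Fin n}

theorem opInv (hr : Run c sched) {k : ℕ} {p : Fin n} {v : QueueOp × ℕ}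
    (h : (c k).pend p = some v) : OpInv c sched k p v.1 v.2 ((c k).proc p) := by
  rcases hr.procInv k p with ⟨-, h'⟩ | ⟨op, t₀, h', -, hop⟩
  · simp [h'] at h
  · obtain rfl : (op, t₀) = v := by simpa [h'] using h
    exact hop

theorem pend_of_writes (hr : Run c sched) {w x r : ℕ} {p : Fin n} (h : Writes c sched w p x r) :
    ∃ t₀ a, (c w).pend p = some (.enq x, t₀) ∧ t₀ < a ∧ a < w ∧ (c a).tail = r := by
  rcases hr.procInv w p with ⟨h', -⟩ | ⟨op, t₀, h', -, hop⟩
  · simp [h.2] at h'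
  · rw [h.2] at hop
    obtain ⟨rfl, a, ha⟩ := hop
    exact ⟨t₀, a, h', ha⟩

theorem proc_of_writes (hr : Run c sched) {w x r : ℕ} {p : Fin n} (h : Writes c sched w p x r) :
    (c (w + 1)).proc p = .done .ok ∧ (c (w + 1)).pend p = (c w).pend p ∧
      (c (w + 1)).items r (p + 1) = .val x := by
  have hstep := hr.2 w
  obtain ⟨hp, h⟩ := h
  rw [hp] at hstep
  generalize c (w + 1) = c' at hstep
  cases hstep <;> simp_all

theorem writes_of_val (hr : Run c sched) {k r s x : ℕ} (h : (c k).items r s = .val x) :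
    ∃ w < k, ∃ p : Fin n, Writes c sched w p x r ∧ s = p + 1 := by
  induction k with
  | zero => simp [hr.1, initConfig] at h
  | succ k ih =>
    by_cases hk : (c k).items r s = .val x
    · obtain ⟨w, hw, h'⟩ := ih hk
      exact ⟨w, by omega, h'⟩
    · obtain ⟨h₁, h₂⟩ := (hr.2 k).write_of_val hk h
      exact ⟨k, by omega, sched k, ⟨rfl, h₁⟩, h₂⟩

theorem writes_unique (hr : Run c sched) {N : ℕ} (hN : EnqueuedOnce c N) {w w' x r r' : ℕ}
    {p p' : Fin n} (hw : w ≤ N) (hw' : w' ≤ N) (h : Writes c sched w p x r)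
    (h' : Writes c sched w' p' x r') : p = p' ∧ r = r' := by
  wlog hle : w ≤ w' generalizing w w' p p' r r'
  · obtain ⟨h₁, h₂⟩ := this hw' hw h' h (by omega)
    exact ⟨h₁.symm, h₂.symm⟩
  obtain ⟨t, a, h₁, -⟩ := hr.pend_of_writes h
  obtain ⟨t', a', h₁', -⟩ := hr.pend_of_writes h'
  obtain ⟨rfl, h₂⟩ := hr.pend_unique h₁ h₁' (hN _ hw _ hw' _ _ _ _ _ h₁ h₁')
  refine ⟨rfl, ?_⟩
  rcases hle.lt_or_eq with hlt | rfl
  · have h₃ := hr.done_mono (Nat.succ_le_of_lt hlt) (h₂ ▸ (hr.pend_spec h₁).1.trans (by omega)) h₁'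
      (hr.proc_of_writes h).1
    simp [h'.2] at h₃
  · have := h.2.symm.trans h'.2
    simp_all

theorem val_unique (hr : Run c sched) {N : ℕ} (hN : EnqueuedOnce c N) {k k' x r s r' s' : ℕ}
    (hk : k ≤ N) (hk' : k' ≤ N) (h : (c k).items r s = .val x) (h' : (c k').items r' s' = .val x) :
    r = r' ∧ s = s' := by
  obtain ⟨w, hw, p, h₁, rfl⟩ := hr.writes_of_val h
  obtain ⟨w', hw', p', h₁', rfl⟩ := hr.writes_of_val h'
  obtain ⟨rfl, rfl⟩ := hr.writes_unique hN (by omega) (by omega) h₁ h₁'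
  exact ⟨rfl, rfl⟩

theorem not_present_of_mark (hr : Run c sched) {N : ℕ} (hN : EnqueuedOnce c N) {j k x r s : ℕ}
    (hj : j ≤ N) (hk : k ≤ N) (h : (c j).items r s = .val x) (h' : (c k).items r s ≠ .val x) :
    ¬ Present c k x := by
  rintro ⟨r', s', h₁⟩
  obtain ⟨rfl, rfl⟩ := hr.val_unique hN hj hk h h₁
  exact h' h₁

theorem exists_take (hr : Run c sched) {a b x r s : ℕ} (hab : a ≤ b)
    (ha : (c a).items r s = .val x) (hb : (c b).items r s = .mark) :
    ∃ m, a ≤ m ∧ m < b ∧ (c m).items r s = .val x ∧ (c (m + 1)).items r s = .mark := by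
  induction b, hab using Nat.le_induction with
  | base => simp [ha] at hb
  | succ b hab ih =>
    rcases hr.val_mono hab ha with h | h
    · exact ⟨b, hab, by omega, h, hb⟩
    · obtain ⟨m, h₁, h₂, h₃⟩ := ih h
      exact ⟨m, h₁, by omega, h₃⟩

theorem take_of_present (hr : Run c sched) {k x : ℕ} (h : Present c k x)
    (h' : ¬ Present c (k + 1) x) :
    ∃ j tk1 tk tl r s, (c k).proc (sched k) = .deqWrite j tk1 tk tl r s (.val x) ∧
      (c k).items r s = .val x ∧ (c (k + 1)).proc (sched k) = .done (.val x) := by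
  obtain ⟨r, s, h⟩ := h
  obtain ⟨⟨j, tk1, tk, tl, h₁⟩, h₂⟩ :=
    (hr.cellInv k).take_of_val (hr.2 k) h fun h₁ => h' ⟨r, s, h₁⟩
  exact ⟨j, tk1, tk, tl, r, s, h₁, h, h₂⟩

theorem fifo (hr : Run c sched) {N : ℕ} (hN : EnqueuedOnce c N) {k x : ℕ} (hk : k < N)
    (h : Present c k x) (h' : ¬ Present c (k + 1) x) {l t₀ : ℕ} {p : Fin n} (hl : l ≤ N)
    (hp : (c l).pend p = some (.enq x, t₀)) {y j : ℕ} (hj : j ≤ t₀ + 1) (hy : Present c j y) :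
    ¬ Present c k y := by
  obtain ⟨i, tk1, tk, tl, r, s, h₁, h₂, -⟩ := hr.take_of_present h h'
  obtain ⟨w, hw, q, h₃, -⟩ := hr.writes_of_val h₂
  obtain ⟨t, a, h₄, hta, haw, htail⟩ := hr.pend_of_writes h₃
  obtain rfl := hN _ (by omega) _ hl _ _ _ _ _ h₄ hp
  rcases hr.procInv k (sched k) with ⟨h₅, -⟩ | ⟨op, u, -, -, h₅⟩
  · simp [h₁] at h₅
  rw [h₁] at h₅
  obtain ⟨-, ⟨T, -, hTk, hsc⟩, -⟩ := h₅
  obtain ⟨r', s', hy⟩ := hy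
  have hb : (c j).items r' s' ≠ .bot := by simp [hy]
  have haT : a < T := by
    by_contra hle
    have h₆ := hr.tail_mono (not_lt.1 hle)
    have h₇ := hsc.tail_eq
    have h₈ := hsc.row_le
    simp only at h₆
    omega
  have hrow : r' < r := by
    have h₆ := ((hr.cellInv j).bounds r' s' hb).2.1
    have h₇ := hr.tail_mono (show j ≤ a by omega)
    simp only at h₇
    omega
  have hmark := hsc.part.mark_of_ne_bot (r := r') (s := s') (.inl hrow)
    (hr.ne_bot_mono (by omega) hb)
  exact hr.not_present_of_mark hN (by omega) (by omega) hy (by simp [hmark])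

end Run

section trace

variable {n : ℕ} {c : ℕ → Config n} {sched : ℕ → Fin n} {N : ℕ}
  {h : ConcHistory QueueOp QueueRes}

theorem Tracks.enqueuedOnce (ht : Tracks c sched N h)
    (hinj : ∀ i j x, h.op i = .enq x → h.op j = .enq x → i = j) : EnqueuedOnce c N := by
  intro k hk l hl p q x t u hp hq
  obtain ⟨i, h₁, rfl, -⟩ := ht.complete k hk p _ hp
  obtain ⟨j, h₂, rfl, -⟩ := ht.complete l hl q _ hq
  rw [hinj i j x h₁ h₂]

theorem Tracks.fin_le (ht : Tracks c sched N h) (i : Fin h.m) : (h.ret i).getD N ≤ N := by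
  cases hi : h.ret i with
  | none => simp
  | some t => simpa using (ht.ret_lt i t hi).le

theorem Tracks.opInv (ht : Tracks c sched N h) (hr : Run c sched) (i : Fin h.m) :
    OpInv c sched ((h.ret i).getD N) (sched (h.inv i)) (h.op i) (h.inv i)
      ((c ((h.ret i).getD N)).proc (sched (h.inv i))) :=
  hr.opInv (ht.pend i)

theorem Tracks.opInv_of_out (ht : Tracks c sched N h) (hr : Run c sched) {i : Fin h.m}
    {r : QueueRes} (hi : h.out i = some r) :
    ∃ t, h.ret i = some t ∧ t < N ∧
      OpInv c sched t (sched (h.inv i)) (h.op i) (h.inv i) (.done r) := by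
  obtain ⟨t, h₁, h₂⟩ := ht.out i r hi
  have := ht.opInv hr i
  rw [h₁, Option.getD_some, h₂] at this
  exact ⟨t, h₁, ht.ret_lt i t h₁, this⟩

/-- A completed enqueue has written its item. -/
theorem OpInv.present (hr : Run c sched) {t t₀ x : ℕ} {p : Fin n} {r : QueueRes}
    (hop : OpInv c sched t p (.enq x) t₀ (.done r)) :
    r = .ok ∧ ∃ j ≤ t, Present c j x := by
  cases r with
  | ok =>
    obtain ⟨y, r, w, hy, -, hw, hwr⟩ := hop
    obtain rfl : x = y := by simpa using hy
    exact ⟨rfl, w + 1, hw, _, _, (hr.proc_of_writes hwr).2.2⟩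
  | _ => simp [OpInv] at hop

theorem Tracks.exists_deq_of_take (ht : Tracks c sched N h) (hr : Run c sched) {k x : ℕ}
    (hk : k < N) (h₁ : Present c k x) (h₂ : ¬ Present c (k + 1) x) :
    ∃ i, ((c ((h.ret i).getD N)).proc (sched (h.inv i))).item = some x := by
  obtain ⟨_, _, _, _, _, _, -, -, hdone⟩ := hr.take_of_present h₁ h₂
  rcases hr.procInv (k + 1) (sched k) with ⟨h₃, -⟩ | ⟨op, t₀, hpend, ht₀, -⟩
  · simp [hdone] at h₃
  obtain ⟨i, rfl, rfl, h₃⟩ := ht.complete (k + 1) hk _ _ hpend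
  obtain ⟨hp, -⟩ := hr.pend_unique hpend (ht.pend i) rfl
  rw [hp] at hdone
  exact ⟨i, PS.item_eq_some_iff.2 (hr.done_mono h₃ ht₀ (ht.pend i) hdone)⟩

/-- All the operations that take `x` are pending when `x` is taken. -/
theorem Tracks.length_takers_le (ht : Tracks c sched N h) (hr : Run c sched)
    (hN : EnqueuedOnce c N) (x : ℕ) :
    ((List.finRange h.m).filter fun i =>
      ((c ((h.ret i).getD N)).proc (sched (h.inv i))).item = some x).length ≤ n := by
  set l := (List.finRange h.m).filter fun i =>
    ((c ((h.ret i).getD N)).proc (sched (h.inv i))).item = some x with hl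
  have hmem : ∀ i ∈ l, ∃ a r s, h.inv i < a ∧ a < (h.ret i).getD N ∧
      (c a).items r s = .val x ∧ (c ((h.ret i).getD N)).items r s = .mark := by
    intro i hi
    have hx := (List.mem_filter.1 hi).2
    rw [decide_eq_true_eq, PS.item_eq_some_iff] at hx
    have hop := ht.opInv hr i
    rw [hx] at hop
    exact hop.2
  have hinj : ∀ i ∈ l, ∀ j ∈ l, sched (h.inv i) = sched (h.inv j) → i = j := by
    intro i hi j hj hij
    obtain ⟨a, r, s, ha, hab, h₁, h₂⟩ := hmem i hi
    obtain ⟨a', r', s', ha', hab', h₁', h₂'⟩ := hmem j hj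
    have hi' := ht.fin_le i
    have hj' := ht.fin_le j
    obtain ⟨rfl, rfl⟩ := hr.val_unique hN (by omega) (by omega) h₁ h₁'
    obtain ⟨m, h₃, h₄, h₅, h₆⟩ := hr.exists_take hab.le h₁ h₂
    have h₇ : a' ≤ m := by
      by_contra hlt
      have := hr.mark_mono (show m + 1 ≤ a' by omega) h₆
      simp [h₁'] at this
    have h₈ : m < (h.ret j).getD N := by
      by_contra hlt
      have := hr.mark_mono (not_lt.1 hlt) h₂'
      simp [h₅] at this
    have hpi := (hr.pend_spec (ht.pend i)).2.2 m (by simp only; omega) h₄.le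
    have hpj := (hr.pend_spec (ht.pend j)).2.2 m (by simp only; omega) h₈.le
    rw [hij, hpj, Option.some.injEq, Prod.ext_iff] at hpi
    exact ht.inj i j hpi.2.symm
  have hnd : (l.map fun i => sched (h.inv i)).Nodup :=
    List.Nodup.map_on hinj ((List.nodup_finRange _).filter _)
  simpa using hnd.length_le_card

/-- The presence of items in the array explains the history of a run. -/
noncomputable def Tracks.presenceTrace (ht : Tracks c sched N h) (hr : Run c sched)
    (hinj : ∀ i j x, h.op i = .enq x → h.op j = .enq x → i = j) : PresenceTrace n h where
  N := N
  Pr := Present c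
  zero := by
    rintro x ⟨r, s, hx⟩
    simp [hr.1, initConfig] at hx
  add_unique := by
    rintro k - x y hx ⟨r, s, hx'⟩ hy ⟨r', s', hy'⟩
    have h₁ := ((hr.2 k).write_of_val (fun h' => hx ⟨r, s, h'⟩) hx').1
    have h₂ := ((hr.2 k).write_of_val (fun h' => hy ⟨r', s', h'⟩) hy').1
    rw [h₁, PS.enq3.injEq] at h₂
    exact h₂.1
  rem_unique := by
    intro k _ x y hx hx' hy hy'
    obtain ⟨_, _, _, _, _, _, -, -, h₁⟩ := hr.take_of_present hx hx'
    obtain ⟨_, _, _, _, _, _, -, -, h₂⟩ := hr.take_of_present hy hy'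
    simpa [h₁] using h₂
  no_return := by
    rintro j k l x hjk hkl hl ⟨r, s, hx⟩ hk
    have hmark : (c k).items r s = .mark :=
      (hr.val_mono hjk hx).resolve_left fun h' => hk ⟨r, s, h'⟩
    exact hr.not_present_of_mark (ht.enqueuedOnce hinj) (by omega) hl hx
      (by simp [hr.mark_mono hkl hmark])
  enq_inj := hinj
  enq_of_pr := by
    rintro j hj x ⟨r, s, hx⟩
    obtain ⟨w, hw, p, h₁, -⟩ := hr.writes_of_val hx
    obtain ⟨t₀, a, h₂, -⟩ := hr.pend_of_writes h₁
    obtain ⟨i, h₃, -⟩ := ht.complete w (by omega) p _ h₂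
    exact ⟨i, h₃⟩
  inv_lt := by
    rintro i x hi j hj ⟨r, s, hx⟩
    obtain ⟨w, hw, p, h₁, -⟩ := hr.writes_of_val hx
    obtain ⟨t₀, a, h₂, h₃, h₄, -⟩ := hr.pend_of_writes h₁
    have := ht.enqueuedOnce hinj w (by omega) _ (ht.fin_le i) p _ x _ _ h₂ (hi ▸ ht.pend i)
    omega
  enq_ret := by
    intro i x hi t hit
    obtain ⟨r, hdone⟩ := ht.ret i t hit
    have hop := ht.opInv hr i
    rw [hit, Option.getD_some, hdone, hi] at hop
    obtain ⟨-, j, hj, hp⟩ := hop.present hr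
    exact ⟨j, hj, hj.trans (ht.ret_lt i t hit).le, hp⟩
  enq_out := by
    intro i x r hi hir
    obtain ⟨t, -, htN, hop⟩ := ht.opInv_of_out hr hir
    rw [hi] at hop
    obtain ⟨h₁, j, hj, hp⟩ := hop.present hr
    exact ⟨h₁, j, by omega, hp⟩
  fifo := by
    intro i x hi k hk h₁ h₂ y j hj hy
    exact hr.fifo (ht.enqueuedOnce hinj) hk h₁ h₂ (ht.fin_le i) (hi ▸ ht.pend i) hj hy
  dq i := ((c ((h.ret i).getD N)).proc (sched (h.inv i))).item
  dq_spec := by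
    intro i x hx
    rw [PS.item_eq_some_iff] at hx
    have hop := ht.opInv hr i
    rw [hx] at hop
    obtain ⟨hdeq, a, r, s, h₁, h₂, h₃, h₄⟩ := hop
    refine ⟨hdeq, fun q hq => ?_, a, _, h₁, h₂.le, ht.fin_le i, fun t hit => by simp [hit],
      ⟨r, s, h₃⟩, ?_⟩
    · obtain ⟨t, h₅, h₆⟩ := ht.out i q hq
      rw [h₅, Option.getD_some, h₆] at hx
      simpa using hx
    · exact hr.not_present_of_mark (ht.enqueuedOnce hinj) (h₂.le.trans (ht.fin_le i))
        (ht.fin_le i) h₃ (by simp [h₄])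
  dq_out := by
    intro i x _ hx
    obtain ⟨t, h₁, h₂⟩ := ht.out i _ hx
    rw [PS.item_eq_some_iff, h₁, Option.getD_some, h₂]
  taker := fun k hk x h₁ h₂ => ht.exists_deq_of_take hr hk h₁ h₂
  takers_card := ht.length_takers_le hr (ht.enqueuedOnce hinj)
  deq_ne_ok := by
    intro i hi hok
    obtain ⟨t, -, -, x, r, w, h₁, -⟩ := ht.opInv_of_out hr hok
    simp [hi] at h₁
  empty_spec := by
    intro i _ hout
    obtain ⟨t, h₁, h₂, -, T, h₃, h₄, h₅⟩ := ht.opInv_of_out hr hout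
    refine ⟨T, h₃, by omega, fun u hu => ?_, fun x ⟨r, s, hx⟩ => h₅ r s x hx⟩
    obtain rfl : t = u := by simpa [h₁] using hu
    exact h₄.le
  weak_spec := by
    intro i _ hout
    obtain ⟨t, h₁, h₂, -, T, h₃, h₄, h₅⟩ := ht.opInv_of_out hr hout
    refine ⟨T, t, h₃, h₄, h₂, fun u hu => ?_, fun x j hj ⟨r, s, hx⟩ => ?_⟩
    · obtain rfl : t = u := by simpa [h₁] using hu
      exact le_rfl
    · have hmark := h₅ r s (hr.ne_bot_mono hj (by simp [hx]))
      exact hr.not_present_of_mark (ht.enqueuedOnce hinj) (by omega) h₂.le hx (by simp [hmark])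

end trace

/-- There exists a wait-free interval-linearizable implementation of the queue with
weak-emptiness check and multiplicity using only read/write base objects: the
algorithm obtained from IntSeqQueue by replacing the Fetch&Increment object with a
read/write wait-free linearizable counter (here taken atomic since it is
linearizable), extending `Items` to a two-dimensional array of read/write
registers, and simulating each Swap by a read followed by a write, is such an
implementation.  Namely: (1) a process that keeps being scheduled completes every
operation it invokes, and (2) every execution (assuming every item is enqueued at
most once) is interval-linearizable w.r.t. the interval-concurrent queue with
weak-emptiness check and multiplicity. -/
theorem rwIntSeqQueue_waitFree_and_intervalLinearizable (n : ℕ) (hn : 1 ≤ n) :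
    (∀ (c : ℕ → Config n) (sched : ℕ → Fin n), Run c sched →
      ∀ i : Fin n, (∀ k, ∃ k' ≥ k, sched k' = i) →
        ∀ k, (c k).pend i ≠ none → ∃ k' > k, (c k').pend i = none) ∧
    (∀ (c : ℕ → Config n) (sched : ℕ → Fin n), Run c sched → ∀ N : ℕ,
      (∀ (i j : Fin (historyAt (c N)).m) (x : ℕ),
          (historyAt (c N)).op i = QueueOp.enq x →
          (historyAt (c N)).op j = QueueOp.enq x → i = j) →
      IntervalLinearizable n (historyAt (c N))) := by
  exact ⟨fun _ _ hr i hi k hk => hr.exists_pend_eq_none i hi k hk,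
    fun _ _ hr N hinj => ((hr.tracks N).presenceTrace hr hinj).intervalLinearizable⟩
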